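/- Let n ≥ 2, β ≥ 0, C₀ > 1 and let χ be a cutoff. Assume α satisfies one of: (i) (n−3)/2 < β < (n−1)/2 and α ≤ 2β − (n−3)/2; or (ii) β ≥ (n−1)/2 and α < β + 1. Then for every 0 < δ < 1 there exists a constant C > 0 such that for every θ ∈ S^{n−1}, all r₁, r₂ ∈ (1−δ, 1+δ) and every Schwartz function q on ℝⁿ, ‖ k^{−1} (S̃_{θ,r₁}(q) − S̃_{θ,r₂}(q)) ‖_{L²_α} ≤ C |r₁ − r₂| ‖q‖²_{W^{β,2}_2}, where (k^{−1}(S̃_{θ,r₁}(q) − S̃_{θ,r₂}(q)))(η) := k(η,θ)^{−1} χ(η) (S_{θ,r₁}(q)(η) − S_{θ,r₂}(q)(η)) for η ∈ H_θ and := 0 for η ∉ H_θ. -/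

import Mathlib

open MeasureTheory Real Filter Set Metric
open scoped FourierTransform RealInnerProductSpace SchwartzMap ENNReal

noncomputable section

abbrev En (n : ℕ) := EuclideanSpace ℝ (Fin n)

/-- Japanese bracket `⟨x⟩ = (1+|x|²)^{1/2}`. -/
def jap {n : ℕ} (x : En n) : ℝ := Real.sqrt (1 + ‖x‖ ^ 2)

/-- `k(η,θ) = -|η|²/(θ·η)`. -/
def kval {n : ℕ} (θ η : En n) : ℝ := -‖η‖ ^ 2 / ⟪θ, η⟫

/-- The Ewald sphere `Γ_r(-2kθ)`, of center `-kθ` and radius `rk`. -/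
def ewald {n : ℕ} (θ η : En n) (r : ℝ) : Set (En n) :=
  Metric.sphere (-(kval θ η • θ)) (r * kval θ η)

/-- The spherical operator `S_{θ,r}`. -/
def Sop {n : ℕ} (θ : En n) (r : ℝ) (q : En n → ℂ) (η : En n) : ℂ :=
  if ⟪η, θ⟫ < 0 then
    ((kval θ η * (r + 1))⁻¹ : ℝ) •
      ∫ ξ in ewald θ η r, 𝓕 q ξ * 𝓕 q (η - ξ) ∂μH[(n : ℝ) - 1]
  else 0

/-- The operator `K_r(g₁,g₂)`. -/
def Kop {n : ℕ} {G₁ G₂ : Type*} [NormedAddCommGroup G₁] [NormedAddCommGroup G₂]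
    (θ : En n) (r : ℝ) (g₁ : En n → G₁) (g₂ : En n → G₂) (η : En n) : ℝ :=
  if ⟪η, θ⟫ < 0 then
    (kval θ η)⁻¹ * ∫ ξ in ewald θ η r, ‖g₁ ξ‖ * ‖g₂ (η - ξ)‖ ∂μH[(n : ℝ) - 1]
  else 0

/-- Weighted norm `‖F‖_{L²_α}`. -/
def L2w {n : ℕ} {G : Type*} [NormedAddCommGroup G] (α : ℝ) (F : En n → G) : ℝ :=
  (∫ η, jap η ^ (2 * α) * ‖F η‖ ^ 2) ^ (1/2 : ℝ)

/-- Weighted Sobolev norm `‖q‖_{W^{β,2}_δ} = ‖⟨·⟩^δ 𝓕⁻¹(⟨·⟩^β 𝓕q)‖_{L²}`. -/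
def sobNorm {n : ℕ} (β δ : ℝ) (q : En n → ℂ) : ℝ :=
  (∫ x, jap x ^ (2 * δ) * ‖𝓕⁻ (fun ξ => (jap ξ ^ β : ℝ) • 𝓕 q ξ) x‖ ^ 2) ^ (1/2 : ℝ)

/-- A smooth radial cutoff vanishing for `|ξ| < C₀` and equal to `1` for `|ξ| > 2C₀`. -/
structure IsCutoff {n : ℕ} (C₀ : ℝ) (χ : En n → ℝ) : Prop where
  smooth : ContDiff ℝ (⊤ : ℕ∞) χ
  mem_Icc : ∀ ξ, χ ξ ∈ Set.Icc (0 : ℝ) 1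
  eq_one : ∀ ξ : En n, 2 * C₀ < ‖ξ‖ → χ ξ = 1
  eq_zero : ∀ ξ : En n, ‖ξ‖ < C₀ → χ ξ = 0

/-- Polar coordinates for lower Lebesgue integrals. -/
lemma polar_lintegral {n : ℕ} (hn : 2 ≤ n) (F : En n → ℝ≥0∞) (hF : Measurable F) :
    ∫⁻ ξ, F ξ = ∫⁻ ω : sphere (0 : En n) 1, ∫⁻ τ in Ioi (0 : ℝ),
      ENNReal.ofReal (τ ^ (n - 1)) * F (τ • ω.1) ∂volume ∂((volume : Measure (En n)).toSphere) := by
  have hnt : Nontrivial (En n) := by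
    have : Nonempty (Fin n) := ⟨⟨0, by omega⟩⟩
    infer_instance
  have hMP := (volume : Measure (En n)).measurePreserving_homeomorphUnitSphereProd
  have hd : Module.finrank ℝ (En n) = n := by simp
  rw [hd] at hMP
  have h1 : ∫⁻ ξ, F ξ = ∫⁻ x : ({0}ᶜ : Set (En n)), F x.1
      ∂((volume : Measure (En n)).comap (Subtype.val)) := by
    rw [lintegral_subtype_comap (measurableSet_singleton (0 : En n)).compl]
    rw [restrict_compl_singleton]
  have h2 : ∫⁻ x : ({0}ᶜ : Set (En n)), F x.1 ∂((volume : Measure (En n)).comap (Subtype.val))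
      = ∫⁻ p : sphere (0 : En n) 1 × Ioi (0 : ℝ), F (p.2.1 • p.1.1)
        ∂(((volume : Measure (En n)).toSphere).prod (Measure.volumeIoiPow (n - 1))) := by
    rw [← hMP.lintegral_comp_emb (Homeomorph.measurableEmbedding _)]
    refine lintegral_congr fun x => ?_
    congr 1
    have hx : ‖x.1‖ ≠ 0 := norm_ne_zero_iff.2 x.2
    simp [smul_smul, hx]
  have hm : Measurable (fun p : sphere (0 : En n) 1 × Ioi (0 : ℝ) => F (p.2.1 • p.1.1)) := by
    apply hF.comp
    fun_prop
  rw [h1, h2, lintegral_prod _ hm.aemeasurable]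
  refine lintegral_congr fun ω => ?_
  rw [Measure.volumeIoiPow, lintegral_withDensity_eq_lintegral_mul]
  · simp only [Pi.mul_apply]
    exact lintegral_subtype_comap measurableSet_Ioi
      (fun τ : ℝ => ENNReal.ofReal (τ ^ (n - 1)) * F (τ • ω.1))
  · fun_prop
  · apply hF.comp
    fun_prop

lemma cap_lower {n : ℕ} (hn : 2 ≤ n) (x : En n) (hx : ‖x‖ = 1) (t : ℝ) (ht : 0 < t) (ht1 : t ≤ 1) :
    volume (ball (0 : En n) 1) * ENNReal.ofReal (t ^ (n - 1)) ≤ ENNReal.ofReal (2 ^ n) *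
      ((volume : Measure (En n)).toSphere.map Subtype.val) (closedBall x (2 * t)) := by
  have hnt : Nontrivial (En n) := by
    have : Nonempty (Fin n) := ⟨⟨0, by omega⟩⟩
    infer_instance
  have h1 : volume (ball x t) = ENNReal.ofReal t * (volume (ball (0 : En n) 1) *
      ENNReal.ofReal (t ^ (n - 1))) := by
    rw [Measure.addHaar_ball _ _ ht.le]
    have : t ^ Module.finrank ℝ (En n) = t * t ^ (n - 1) := by
      rw [← pow_succ']; congr 1; simp; omega
    rw [this, ENNReal.ofReal_mul ht.le]
    ring
  have h2 : volume (ball x t) ≤ ENNReal.ofReal t * (ENNReal.ofReal (2 ^ n) *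
      ((volume : Measure (En n)).toSphere.map Subtype.val) (closedBall x (2 * t))) := by
    have e1 : volume (ball x t) = ∫⁻ ξ, (ball x t).indicator (fun _ => (1 : ℝ≥0∞)) ξ := by
      rw [lintegral_indicator measurableSet_ball]; simp
    rw [e1, polar_lintegral hn _ (measurable_const.indicator measurableSet_ball)]
    rw [Measure.map_apply measurable_subtype_coe measurableSet_closedBall]
    have e2 : ∀ ω : sphere (0 : En n) 1, ∫⁻ τ in Ioi (0 : ℝ),
        ENNReal.ofReal (τ ^ (n - 1)) * (ball x t).indicator (fun _ => (1 : ℝ≥0∞)) (τ • ω.1) ≤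
        (Subtype.val ⁻¹' closedBall x (2 * t)).indicator
          (fun _ => ENNReal.ofReal t * ENNReal.ofReal (2 ^ n)) ω := by
      intro ω
      have hω : ‖ω.1‖ = 1 := by simp
      by_cases hc : ω ∈ (Subtype.val ⁻¹' closedBall x (2 * t) : Set (sphere (0 : En n) 1))
      · rw [indicator_of_mem hc]
        calc _ ≤ ∫⁻ τ in Ioi (0 : ℝ), (Ioo (1 - t) (1 + t)).indicator
              (fun _ => ENNReal.ofReal (2 ^ (n - 1))) τ := by
              refine setLIntegral_mono' measurableSet_Ioi fun τ hτ => ?_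
              by_cases hb : τ • ω.1 ∈ ball x t
              · rw [indicator_of_mem hb, mul_one]
                have hτ' : (0 : ℝ) < τ := hτ
                have h3 : |τ - 1| < t := by
                  have := abs_norm_sub_norm_le (τ • ω.1) x
                  rw [norm_smul, hω, hx, mul_one, Real.norm_of_nonneg hτ'.le] at this
                  exact this.trans_lt (by simpa [dist_eq_norm] using hb)
                rw [abs_lt] at h3
                rw [indicator_of_mem (by constructor <;> linarith)]
                gcongr
                linarith
              · rw [indicator_of_notMem hb]; simp
          _ ≤ ∫⁻ τ, (Ioo (1 - t) (1 + t)).indicator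
              (fun _ => ENNReal.ofReal (2 ^ (n - 1))) τ := setLIntegral_le_lintegral _ _
          _ = ENNReal.ofReal t * ENNReal.ofReal (2 ^ n) := by
              rw [lintegral_indicator measurableSet_Ioo]
              simp only [lintegral_const, MeasurableSet.univ, Measure.restrict_apply, univ_inter,
                Real.volume_Ioo]
              rw [← ENNReal.ofReal_mul (by positivity), ← ENNReal.ofReal_mul (by positivity)]
              congr 1
              have : (2 : ℝ) ^ n = 2 ^ (n - 1) * 2 := by rw [← pow_succ]; congr 1; omega
              rw [this]; ring
      · rw [indicator_of_notMem hc]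
        refine le_of_eq ?_
        rw [setLIntegral_congr_fun (g := fun _ => 0) measurableSet_Ioi]
        · simp
        · intro τ hτ
          have hτ' : (0 : ℝ) < τ := hτ
          have hb : τ • ω.1 ∉ ball x t := by
            intro hb
            apply hc
            have hb' : ‖τ • ω.1 - x‖ < t := by simpa [dist_eq_norm] using hb
            have h3 : |τ - 1| < t := by
              have := abs_norm_sub_norm_le (τ • ω.1) x
              rw [norm_smul, hω, hx, mul_one, Real.norm_of_nonneg hτ'.le] at this
              exact this.trans_lt hb'
            have h4 : ‖ω.1 - τ • ω.1‖ = |τ - 1| := by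
              have : ω.1 - τ • ω.1 = (1 - τ) • ω.1 := by rw [sub_smul, one_smul]
              rw [this, norm_smul, hω, mul_one, Real.norm_eq_abs, abs_sub_comm]
            show dist ω.1 x ≤ 2 * t
            rw [dist_eq_norm]
            have := norm_add_le (ω.1 - τ • ω.1) (τ • ω.1 - x)
            rw [sub_add_sub_cancel] at this
            linarith
          simp [indicator_of_notMem hb]
    refine (lintegral_mono e2).trans ?_
    rw [lintegral_indicator (measurable_subtype_coe measurableSet_closedBall)]
    simp [mul_assoc]
  rw [h1] at h2
  exact (ENNReal.mul_le_mul_iff_right (by simpa using ht) ENNReal.ofReal_ne_top).1 h2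

lemma hausdorff_dom {n : ℕ} (hn : 2 ≤ n) : ∃ C : ℝ≥0∞, C ≠ ⊤ ∧
    (μH[(n : ℝ) - 1] : Measure (En n)).restrict (sphere 0 1) ≤
      C • ((volume : Measure (En n)).toSphere.map Subtype.val) := by
  set σ : Measure (En n) := (volume : Measure (En n)).toSphere.map Subtype.val with hσ
  have hfin : IsFiniteMeasure σ := by rw [hσ]; infer_instance
  set V := volume (ball (0 : En n) 1) with hV
  have hV0 : V ≠ 0 := (measure_ball_pos _ _ one_pos).ne'
  have hVt : V ≠ ⊤ := measure_ball_lt_top.ne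
  set C : ℝ≥0∞ := ENNReal.ofReal (20 ^ (n - 1)) * (V⁻¹ * ENNReal.ofReal (2 ^ n)) with hC
  refine ⟨C, ENNReal.mul_ne_top ENNReal.ofReal_ne_top
    (ENNReal.mul_ne_top (ENNReal.inv_ne_top.2 hV0) ENNReal.ofReal_ne_top), ?_⟩
  have key : ∀ x : En n, ‖x‖ = 1 → ∀ r : ℝ, 0 < r → r ≤ 2 →
      ENNReal.ofReal ((10 * r) ^ (n - 1)) ≤ C * σ (closedBall x r) := by
    intro x hx r hr hr2
    have := cap_lower hn x hx (r / 2) (by linarith) (by linarith)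
    rw [show 2 * (r / 2) = r by ring] at this
    have h2 : ENNReal.ofReal ((r / 2) ^ (n - 1)) ≤ V⁻¹ * ENNReal.ofReal (2 ^ n) * σ (closedBall x r) := by
      rw [mul_assoc]
      rw [← ENNReal.mul_le_iff_le_inv hV0 hVt]
      exact this
    have h3 : (10 * r) ^ (n - 1) = 20 ^ (n - 1) * (r / 2) ^ (n - 1) := by
      rw [← mul_pow]; congr 1; ring
    rw [h3, ENNReal.ofReal_mul (by positivity), hC, mul_assoc]
    gcongr
  have main : ∀ A : Set (En n), A ⊆ sphere 0 1 → ∀ U, IsOpen U → A ⊆ U →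
      μH[(n : ℝ) - 1] A ≤ C * σ U := by
    intro A hA U hU hAU
    have hch : ∀ (j : ℕ) (x : En n), ∃ r : ℝ, 0 < r ∧ r ≤ 1 / ((j : ℝ) + 1) ∧ (x ∈ A → closedBall x r ⊆ U) := by
      intro j x
      by_cases hx : x ∈ A
      · obtain ⟨e, he, hs⟩ := Metric.isOpen_iff.1 hU x (hAU hx)
        refine ⟨min (e / 2) (1 / ((j : ℝ) + 1)), by positivity, min_le_right _ _, fun _ => ?_⟩
        refine (closedBall_subset_ball ?_).trans hs
        exact (min_le_left _ _).trans_lt (by linarith)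
      · exact ⟨1 / ((j : ℝ) + 1), by positivity, le_rfl, fun h => absurd h hx⟩
    choose r hr0 hr1 hrU using hch
    have hV := fun j => Vitali.exists_disjoint_subfamily_covering_enlargement_closedBall A
      (fun x : En n => x) (r j) (1 / ((j : ℝ) + 1)) (fun a _ => hr1 j a) 5 (by norm_num)
    choose u huA hud huc using hV
    have hcount : ∀ j, (u j).Countable := fun j => by
      refine (hud j).countable_of_nonempty_interior fun a ha => ?_
      exact ⟨a, ball_subset_interior_closedBall (mem_ball_self (hr0 j a))⟩
    have : ∀ j, Countable (u j) := fun j => (hcount j).to_subtype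
    have hlim := Measure.hausdorffMeasure_le_liminf_tsum (ι := fun j => u j) ((n : ℝ) - 1) A (l := atTop)
      (fun j : ℕ => ENNReal.ofReal (10 * (1 / ((j : ℝ) + 1)))) ?_
      (fun j a => closedBall a.1 (5 * r j a.1)) ?_ ?_
    · refine hlim.trans ?_
      refine (liminf_le_liminf (v := fun _ : ℕ => C * σ U) ?_).trans (by simp)
      refine Eventually.of_forall fun j => ?_
      calc ∑' a : u j, ediam (closedBall a.1 (5 * r j a.1)) ^ ((n : ℝ) - 1)
          ≤ ∑' a : u j, C * σ (closedBall a.1 (r j a.1)) := by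
            refine ENNReal.tsum_le_tsum fun a => ?_
            have ha : ‖a.1‖ = 1 := by simpa using hA (huA j a.2)
            refine le_trans ?_ (key a.1 ha (r j a.1) (hr0 j _) ((hr1 j _).trans ?_))
            · have h1 : ediam (closedBall a.1 (5 * r j a.1)) ≤ ENNReal.ofReal (10 * r j a.1) := by
                have h5 : 0 ≤ 5 * r j a.1 := by have := hr0 j a.1; positivity
                rw [← Metric.closedEBall_ofReal h5]
                refine ediam_closedEBall_le.trans ?_
                rw [show (2 : ℝ≥0∞) = ENNReal.ofReal 2 by simp, ← ENNReal.ofReal_mul (by norm_num)]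
                apply ENNReal.ofReal_le_ofReal; linarith
              have hn1 : (n : ℝ) - 1 = ((n - 1 : ℕ) : ℝ) := by
                rw [Nat.cast_sub (by omega)]; simp
              rw [hn1, ENNReal.rpow_natCast]
              rw [ENNReal.ofReal_pow (by have := hr0 j a.1; positivity)]
              gcongr
            · rw [div_le_iff₀ (by positivity)]
              have : (0 : ℝ) ≤ j := Nat.cast_nonneg j
              linarith
        _ = C * ∑' a : u j, σ (closedBall a.1 (r j a.1)) := ENNReal.tsum_mul_left
        _ = C * σ (⋃ a ∈ u j, closedBall a (r j a)) := by
            rw [measure_biUnion (hcount j) (hud j) (fun _ _ => measurableSet_closedBall)]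
        _ ≤ C * σ U := by
            gcongr
            exact iUnion₂_subset fun a ha => hrU j a (huA j ha)
    · rw [show (0 : ℝ≥0∞) = ENNReal.ofReal (10 * 0) by simp]
      exact ENNReal.tendsto_ofReal (tendsto_one_div_add_atTop_nhds_zero_nat.const_mul 10)
    · refine Eventually.of_forall fun j a => ?_
      have h5 : 0 ≤ 5 * r j a.1 := by have := hr0 j a.1; positivity
      rw [← Metric.closedEBall_ofReal h5]
      refine ediam_closedEBall_le.trans ?_
      rw [show (2 : ℝ≥0∞) = ENNReal.ofReal 2 by simp, ← ENNReal.ofReal_mul (by norm_num)]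
      apply ENNReal.ofReal_le_ofReal
      have := hr1 j a.1
      linarith
    · refine Eventually.of_forall fun j a ha => ?_
      obtain ⟨b, hb, hs⟩ := huc j a ha
      exact mem_iUnion.2 ⟨⟨b, hb⟩, hs (mem_closedBall_self (hr0 j a).le)⟩
  refine Measure.le_iff.2 fun A hA => ?_
  rw [Measure.restrict_apply hA, Measure.smul_apply, smul_eq_mul]
  have hb : μH[(n : ℝ) - 1] (A ∩ sphere 0 1) ≤ C * σ (A ∩ sphere 0 1) := by
    rw [(A ∩ sphere 0 1).measure_eq_iInf_isOpen σ]
    by_cases hC0 : C = 0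
    · have := main (A ∩ sphere 0 1) inter_subset_right univ isOpen_univ (subset_univ _)
      simpa [hC0] using this
    rw [ENNReal.mul_iInf_of_ne hC0 (ENNReal.mul_ne_top ENNReal.ofReal_ne_top
      (ENNReal.mul_ne_top (ENNReal.inv_ne_top.2 hV0) ENNReal.ofReal_ne_top))]
    refine le_iInf fun U => ?_
    by_cases hU : A ∩ sphere 0 1 ⊆ U
    · by_cases hUo : IsOpen U
      · simpa [hU, hUo] using main _ inter_subset_right U hUo hU
      · simp [hU, hUo, ENNReal.mul_top hC0]
    · simp [hU, ENNReal.mul_top hC0]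
  exact hb.trans (by gcongr; exact inter_subset_left)

open scoped Pointwise in
lemma sphere_scale {n : ℕ} (hn : 2 ≤ n) (c : En n) (ρ : ℝ) (hρ : 0 < ρ) (G : En n → ℂ) :
    ∫ ξ in sphere c ρ, G ξ ∂(μH[(n : ℝ) - 1]) =
      (ρ ^ (n - 1) : ℝ) • ∫ ω in sphere (0 : En n) 1, G (c + ρ • ω) ∂(μH[(n : ℝ) - 1]) := by
  have hd : (0 : ℝ) ≤ (n : ℝ) - 1 := by
    have : (2 : ℝ) ≤ n := by exact_mod_cast hn
    linarith
  have hn1 : (n : ℝ) - 1 = ((n - 1 : ℕ) : ℝ) := by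
    rw [Nat.cast_sub (by omega)]; simp
  set e : En n ≃ₜ En n := (Homeomorph.smulOfNeZero ρ hρ.ne').trans (Homeomorph.addLeft c) with he
  have hea : ∀ x, e x = c + ρ • x := fun x => rfl
  have hmap : (μH[(n : ℝ) - 1] : Measure (En n)) =
      ENNReal.ofReal (ρ ^ (n - 1)) • (μH[(n : ℝ) - 1] : Measure (En n)).map e := by
    ext s hs
    rw [Measure.smul_apply, Measure.map_apply e.continuous.measurable hs]
    have h1 : s = (IsometryEquiv.addLeft c) '' (ρ • (e ⁻¹' s)) := by
      ext x
      constructor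
      · intro hx
        refine ⟨ρ • (e.symm x), smul_mem_smul_set (by simpa using hx), ?_⟩
        have := e.apply_symm_apply x
        rw [hea] at this
        simpa using this
      · rintro ⟨y, ⟨z, hz, rfl⟩, rfl⟩
        simpa [hea] using hz
    conv_lhs => rw [h1]
    rw [IsometryEquiv.hausdorffMeasure_image, Measure.hausdorffMeasure_smul₀ hd hρ.ne']
    rw [hn1, NNReal.rpow_natCast]
    rw [ENNReal.smul_def, smul_eq_mul, smul_eq_mul]
    congr 1
    rw [ENNReal.ofReal, ENNReal.coe_inj, Real.toNNReal_pow hρ.le]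
    congr 1
    ext
    simp [abs_of_pos hρ]
    exact hρ.le
  conv_lhs => rw [hmap]
  rw [Measure.restrict_smul, integral_smul_measure, ENNReal.toReal_ofReal (by positivity)]
  congr 1
  rw [e.measurableEmbedding.setIntegral_map]
  have : e ⁻¹' sphere c ρ = sphere 0 1 := by
    ext x
    simp only [mem_preimage, hea, mem_sphere_iff_norm, add_sub_cancel_left, norm_smul,
      Real.norm_of_nonneg hρ.le, sub_zero]
    constructor
    · intro h; field_simp at h; exact h
    · intro h; rw [h, mul_one]
  rw [this]
  rfl

lemma oneD (h h' M : ℝ → ℝ) (t L : ℝ) (hL : 0 < L) (hd : ∀ τ, HasDerivAt h (h' τ) τ)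
    (hM : Continuous M) (hc : Continuous h')
    (hb : ∀ τ ∈ Icc t (t + L), |h τ| / L + |h' τ| ≤ M τ) :
    ENNReal.ofReal (h t) ≤ ∫⁻ τ in Ioc t (t + L), ENNReal.ofReal (M τ) := by
  have hcont : Continuous h := continuous_iff_continuousAt.2 fun τ => (hd τ).continuousAt
  have hdd : ∀ τ, HasDerivAt (fun τ => -((t + L - τ) / L * h τ))
      (h τ / L - (t + L - τ) / L * h' τ) τ := by
    intro τ
    have h1 : HasDerivAt (fun τ : ℝ => (t + L - τ) / L) (-1 / L) τ :=
      (((hasDerivAt_id τ).const_sub (t + L)).div_const L)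
    refine (h1.mul (hd τ)).neg.congr_deriv ?_
    ring
  have hIntg : ∫ τ in t..(t + L), (h τ / L - (t + L - τ) / L * h' τ) = h t := by
    rw [intervalIntegral.integral_eq_sub_of_hasDerivAt (fun τ _ => hdd τ)
      (Continuous.intervalIntegrable (by fun_prop) _ _)]
    simp [hL.ne']
  have hle : h t ≤ ∫ τ in t..(t + L), M τ := by
    rw [← hIntg]
    apply intervalIntegral.integral_mono_on (by linarith)
      (Continuous.intervalIntegrable (by fun_prop) _ _) (hM.intervalIntegrable _ _)
    intro τ hτ
    refine le_trans ?_ (hb τ hτ)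
    have h1 : h τ / L ≤ |h τ| / L := by gcongr; exact le_abs_self _
    have h2 : |(t + L - τ) / L * h' τ| ≤ |h' τ| := by
      rw [abs_mul]
      have : |(t + L - τ) / L| ≤ 1 := by
        rw [abs_of_nonneg (div_nonneg (by linarith [hτ.2]) hL.le), div_le_one hL]
        linarith [hτ.1]
      exact mul_le_of_le_one_left (abs_nonneg _) this
    linarith [neg_abs_le ((t + L - τ) / L * h' τ)]
  refine (ENNReal.ofReal_le_ofReal hle).trans ?_
  rw [intervalIntegral.integral_of_le (by linarith), ofReal_integral_eq_lintegral_ofReal]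
  · exact (hM.integrableOn_Icc).mono_set Ioc_subset_Icc_self
  · filter_upwards [ae_restrict_mem measurableSet_Ioc] with τ hτ
    refine le_trans ?_ (hb τ (Ioc_subset_Icc_self hτ))
    positivity

lemma trace_ineq {n : ℕ} (hn : 2 ≤ n) (F : En n → ℝ≥0∞) (hF : Measurable F) (c : En n) (t : ℝ)
    (ht : 0 < t) (h : sphere (0 : En n) 1 → ℝ≥0∞)
    (hb : ∀ ω, h ω ≤ ∫⁻ τ in Ioi t, F (c + τ • ω.1)) :
    ENNReal.ofReal (t ^ (n - 1)) * ∫⁻ ω, h ω ∂((volume : Measure (En n)).toSphere) ≤ ∫⁻ ξ, F ξ := by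
  rw [← lintegral_add_left_eq_self F c, polar_lintegral hn (fun ξ => F (c + ξ)) (by fun_prop),
    ← lintegral_const_mul' _ _ ENNReal.ofReal_ne_top]
  refine lintegral_mono fun ω => ?_
  calc _ ≤ ENNReal.ofReal (t ^ (n - 1)) * ∫⁻ τ in Ioi t, F (c + τ • ω.1) := by gcongr; exact hb ω
    _ = ∫⁻ τ in Ioi t, ENNReal.ofReal (t ^ (n - 1)) * F (c + τ • ω.1) :=
      (lintegral_const_mul' _ _ ENNReal.ofReal_ne_top).symm
    _ ≤ ∫⁻ τ in Ioi t, ENNReal.ofReal (τ ^ (n - 1)) * F (c + τ • ω.1) := by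
      refine setLIntegral_mono' measurableSet_Ioi fun τ hτ => ?_
      have : t < τ := hτ
      gcongr
    _ ≤ _ := lintegral_mono_set (Ioi_subset_Ioi ht.le)

lemma jap_pos {n : ℕ} (x : En n) : 0 < jap x := Real.sqrt_pos.2 (by positivity)
lemma one_le_jap {n : ℕ} (x : En n) : 1 ≤ jap x := by
  unfold jap; rw [Real.one_le_sqrt]; nlinarith [norm_nonneg x]
lemma norm_le_jap {n : ℕ} (x : En n) : ‖x‖ ≤ jap x := by
  unfold jap; apply Real.le_sqrt_of_sq_le; linarith
lemma jap_sq {n : ℕ} (x : En n) : jap x ^ 2 = 1 + ‖x‖ ^ 2 := Real.sq_sqrt (by positivity)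
lemma continuous_jap {n : ℕ} : Continuous (jap : En n → ℝ) := by unfold jap; fun_prop

lemma jap_ray {n : ℕ} (y ω : En n) (e τ : ℝ) : HasDerivAt (fun τ => jap (y + τ • ω) ^ e)
    (⟪y + τ • ω, ω⟫ / jap (y + τ • ω) * (e * jap (y + τ • ω) ^ (e - 1))) τ := by
  have h0 : HasDerivAt (fun τ : ℝ => y + τ • ω) ω τ := by
    simpa using ((hasDerivAt_id τ).smul_const ω).const_add y
  have h1 := (h0.norm_sq.const_add 1).sqrt (by positivity)
  have h2 : HasDerivAt (fun τ => jap (y + τ • ω)) (⟪y + τ • ω, ω⟫ / jap (y + τ • ω)) τ := by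
    refine h1.congr_deriv ?_
    show 2 * ⟪y + τ • ω, ω⟫ / (2 * jap (y + τ • ω)) = _
    field_simp
  refine (h2.rpow_const (p := e) (Or.inl (jap_pos _).ne')).congr_deriv ?_
  ring

lemma jap_ray_cont {n : ℕ} (y ω : En n) (e : ℝ) : Continuous (fun τ : ℝ =>
    (⟪y + τ • ω, ω⟫ / jap (y + τ • ω) * (e * jap (y + τ • ω) ^ (e - 1)))) := by
  have h : Continuous (fun τ : ℝ => jap (y + τ • ω)) := continuous_jap.comp (by fun_prop)
  refine Continuous.mul (Continuous.div (by fun_prop) h fun τ => (jap_pos _).ne') ?_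
  exact continuous_const.mul (h.rpow_const fun τ => Or.inl (jap_pos _).ne')

lemma jap_ray_bound {n : ℕ} (x ω : En n) (hω : ‖ω‖ = 1) (e : ℝ) :
    |⟪x, ω⟫ / jap x * (e * jap x ^ (e - 1))| ≤ |e| * jap x ^ (e - 1) := by
  rw [abs_mul, abs_mul, abs_of_pos (Real.rpow_pos_of_pos (jap_pos x) _)]
  have : |⟪x, ω⟫ / jap x| ≤ 1 := by
    rw [abs_div, abs_of_pos (jap_pos x), div_le_one (jap_pos x)]
    refine (abs_real_inner_le_norm x ω).trans ?_
    rw [hω, mul_one]; exact norm_le_jap x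
  have h0 : 0 ≤ |e| * jap x ^ (e - 1) := mul_nonneg (abs_nonneg _) (Real.rpow_nonneg (jap_pos x).le _)
  exact mul_le_of_le_one_left h0 this

lemma pow_int {n : ℕ} (hn : 2 ≤ n) (a : ℝ) (ha : 0 ≤ a) (han : a < n) : ∃ C : ℝ, 0 ≤ C ∧
    ∀ R : ℝ, 0 < R → ∫⁻ x in closedBall (0 : En n) R, ENNReal.ofReal (jap x ^ (-a)) ≤
      ENNReal.ofReal (C * R ^ ((n : ℝ) - a)) := by
  set S := (volume : Measure (En n)).toSphere univ with hS
  have hSt : S ≠ ⊤ := measure_ne_top _ _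
  refine ⟨S.toReal * ((n : ℝ) - a)⁻¹, by have : 0 < (n : ℝ) - a := by linarith
                                         positivity, fun R hR => ?_⟩
  have hjm : Measurable (fun x : En n => ENNReal.ofReal (jap x ^ (-a))) :=
    (continuous_jap.measurable.pow_const _).ennreal_ofReal
  rw [← lintegral_indicator measurableSet_closedBall,
    polar_lintegral hn _ (hjm.indicator measurableSet_closedBall)]
  have h1 : ∀ ω : sphere (0 : En n) 1, ∫⁻ τ in Ioi (0 : ℝ), ENNReal.ofReal (τ ^ (n - 1)) *
      (closedBall (0 : En n) R).indicator (fun x => ENNReal.ofReal (jap x ^ (-a))) (τ • ω.1) ≤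
      ENNReal.ofReal (R ^ ((n : ℝ) - a) / ((n : ℝ) - a)) := by
    intro ω
    have hω : ‖ω.1‖ = 1 := by simp
    calc _ ≤ ∫⁻ τ in Ioi (0 : ℝ), (Ioc 0 R).indicator
          (fun τ => ENNReal.ofReal (τ ^ ((n : ℝ) - a - 1))) τ := by
          refine setLIntegral_mono' measurableSet_Ioi fun τ hτ => ?_
          have hτ' : (0 : ℝ) < τ := hτ
          have hnorm : ‖τ • ω.1‖ = τ := by rw [norm_smul, hω, mul_one, Real.norm_of_nonneg hτ'.le]
          by_cases hb : τ • ω.1 ∈ closedBall (0 : En n) R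
          · rw [indicator_of_mem hb]
            have : τ ≤ R := by simpa [hnorm] using hb
            rw [indicator_of_mem (show τ ∈ Ioc 0 R from ⟨hτ', this⟩), ← ENNReal.ofReal_mul (by positivity)]
            apply ENNReal.ofReal_le_ofReal
            have hn1 : ((n - 1 : ℕ) : ℝ) = (n : ℝ) - 1 := by
              rw [Nat.cast_sub (by omega)]; simp
            have e1 : τ ^ ((n : ℝ) - a - 1) = τ ^ (n - 1) * τ ^ (-a) := by
              rw [← Real.rpow_natCast, ← Real.rpow_add hτ', hn1]; congr 1; ring
            rw [e1]
            refine mul_le_mul_of_nonneg_left ?_ (by positivity)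
            apply Real.rpow_le_rpow_of_nonpos hτ' _ (by linarith)
            calc τ = ‖τ • ω.1‖ := hnorm.symm
              _ ≤ _ := norm_le_jap _
          · rw [indicator_of_notMem hb]; simp
      _ ≤ ∫⁻ τ, (Ioc 0 R).indicator
          (fun τ => ENNReal.ofReal (τ ^ ((n : ℝ) - a - 1))) τ := setLIntegral_le_lintegral _ _
      _ = ENNReal.ofReal (∫ τ in Ioc 0 R, τ ^ ((n : ℝ) - a - 1)) := by
          rw [lintegral_indicator measurableSet_Ioc, ofReal_integral_eq_lintegral_ofReal]
          · exact (intervalIntegral.intervalIntegrable_rpow' (by linarith)).1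
          · filter_upwards [ae_restrict_mem measurableSet_Ioc] with τ hτ
            exact Real.rpow_nonneg hτ.1.le _
      _ = _ := by
          rw [← intervalIntegral.integral_of_le hR.le, integral_rpow (Or.inl (by linarith))]
          have : (n : ℝ) - a - 1 + 1 = n - a := by ring
          rw [this, Real.zero_rpow (by linarith), sub_zero]
  refine (lintegral_mono h1).trans ?_
  rw [lintegral_const, ← hS]
  rw [← ENNReal.ofReal_toReal hSt, ← ENNReal.ofReal_mul, ENNReal.toReal_ofReal]
  · apply le_of_eq; congr 1; field_simp
  · positivity
  · have : 0 < (n : ℝ) - a := by linarith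
    positivity

lemma pow_int' {n : ℕ} (hn : 2 ≤ n) (a : ℝ) (ha : 0 ≤ a) (han : a < n) : ∃ C : ℝ, 0 ≤ C ∧
    ∀ y : En n, ∀ R : ℝ, 0 < R → ∫⁻ x in closedBall y R, ENNReal.ofReal (jap x ^ (-a)) ≤
      ENNReal.ofReal (C * R ^ ((n : ℝ) - a)) := by
  obtain ⟨C, hC, h⟩ := pow_int hn a ha han
  set V := volume (closedBall (0 : En n) 1) with hV
  have hVt : V ≠ ⊤ := measure_closedBall_lt_top.ne
  have hnt : Nontrivial (En n) := by
    have : Nonempty (Fin n) := ⟨⟨0, by omega⟩⟩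
    infer_instance
  refine ⟨C + V.toReal, by positivity, fun y R hR => ?_⟩
  have hsub : closedBall y R ⊆ closedBall (0 : En n) R ∪ (closedBall y R \ closedBall (0 : En n) R) := by
    intro x hx
    by_cases h0 : x ∈ closedBall (0 : En n) R
    · exact Or.inl h0
    · exact Or.inr ⟨hx, h0⟩
  refine (lintegral_mono_set hsub).trans ((lintegral_union_le _ _ _).trans ?_)
  rw [add_mul, ENNReal.ofReal_add (by positivity) (by positivity)]
  refine add_le_add (h R hR) ?_
  calc ∫⁻ x in closedBall y R \ closedBall (0 : En n) R, ENNReal.ofReal (jap x ^ (-a))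
      ≤ ∫⁻ x in closedBall y R \ closedBall (0 : En n) R, ENNReal.ofReal (R ^ (-a)) := by
        refine setLIntegral_mono' (measurableSet_closedBall.diff measurableSet_closedBall)
          fun x hx => ?_
        apply ENNReal.ofReal_le_ofReal
        apply Real.rpow_le_rpow_of_nonpos hR _ (by linarith)
        have : R < ‖x‖ := by simpa using hx.2
        exact this.le.trans (norm_le_jap x)
    _ ≤ ENNReal.ofReal (R ^ (-a)) * volume (closedBall y R) := by
        rw [setLIntegral_const]; gcongr; exact sdiff_subset
    _ = _ := by
        rw [Measure.addHaar_closedBall' _ _ hR.le, ← hV]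
        nth_rw 1 [← ENNReal.ofReal_toReal hVt]
        rw [← ENNReal.ofReal_mul (by positivity), ← ENNReal.ofReal_mul (by positivity)]
        congr 1
        have : R ^ ((n : ℝ) - a) = R ^ n * R ^ (-a) := by
          rw [← Real.rpow_natCast, ← Real.rpow_add hR]; rfl
        rw [this]
        simp
        ring

lemma sphere_pow {n : ℕ} (hn : 2 ≤ n) (s : ℝ) (hs : 0 ≤ s) (hsn : 2 * s < (n : ℝ) - 1) :
    ∃ C : ℝ, 0 ≤ C ∧ ∀ y : En n, ∀ t : ℝ, 0 < t →
      ∫⁻ ω : sphere (0 : En n) 1, ENNReal.ofReal (jap (y + t • ω.1) ^ (-(2 * s)))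
        ∂((volume : Measure (En n)).toSphere) ≤ ENNReal.ofReal (C * t ^ (-(2 * s))) := by
  obtain ⟨C₁, hC₁, h₁⟩ := pow_int' hn (2 * s) (by linarith) (by linarith)
  obtain ⟨C₂, hC₂, h₂⟩ := pow_int' hn (2 * s + 1) (by linarith) (by linarith)
  have hn0 : (0 : ℝ) < n := by
    have : (2 : ℝ) ≤ n := by exact_mod_cast hn
    linarith
  refine ⟨C₁ * 2 ^ ((n : ℝ) - 2 * s) + 2 * s * (C₂ * 2 ^ ((n : ℝ) - (2 * s + 1))), by positivity,
    fun y t ht => ?_⟩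
  set M : En n → ℝ := fun x => t⁻¹ * jap x ^ (-(2 * s)) + 2 * s * jap x ^ (-(2 * s + 1)) with hM
  have hMc : Continuous M := by
    refine Continuous.add (continuous_const.mul ?_) (continuous_const.mul ?_) <;>
    exact continuous_jap.rpow_const fun x => Or.inl (jap_pos x).ne'
  have htr := trace_ineq hn ((closedBall y (2 * t)).indicator fun x => ENNReal.ofReal (M x))
    (hMc.measurable.ennreal_ofReal.indicator measurableSet_closedBall) y t ht
    (fun ω => ENNReal.ofReal (jap (y + t • ω.1) ^ (-(2 * s)))) ?_
  · rw [lintegral_indicator measurableSet_closedBall] at htr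
    have hb : ∫⁻ x in closedBall y (2 * t), ENNReal.ofReal (M x) ≤ ENNReal.ofReal (t ^ (n - 1)) *
      ENNReal.ofReal ((C₁ * 2 ^ ((n : ℝ) - 2 * s) + 2 * s * (C₂ * 2 ^ ((n : ℝ) - (2 * s + 1)))) *
        t ^ (-(2 * s))) := by
      have hsplit : ∀ x, ENNReal.ofReal (M x) = ENNReal.ofReal t⁻¹ * ENNReal.ofReal (jap x ^ (-(2 * s)))
          + ENNReal.ofReal (2 * s) * ENNReal.ofReal (jap x ^ (-(2 * s + 1))) := by
        intro x
        have := jap_pos x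
        rw [hM, ENNReal.ofReal_add (by positivity) (by positivity), ENNReal.ofReal_mul (by positivity),
          ENNReal.ofReal_mul (by positivity)]
      simp_rw [hsplit]
      rw [lintegral_add_left, lintegral_const_mul' _ _ ENNReal.ofReal_ne_top,
        lintegral_const_mul' _ _ ENNReal.ofReal_ne_top]
      · calc _ ≤ ENNReal.ofReal t⁻¹ * ENNReal.ofReal (C₁ * (2 * t) ^ ((n : ℝ) - 2 * s)) +
            ENNReal.ofReal (2 * s) * ENNReal.ofReal (C₂ * (2 * t) ^ ((n : ℝ) - (2 * s + 1))) := by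
              gcongr
              · exact h₁ y (2 * t) (by linarith)
              · exact h₂ y (2 * t) (by linarith)
          _ = _ := by
              rw [← ENNReal.ofReal_mul (by positivity), ← ENNReal.ofReal_mul (by positivity),
                ← ENNReal.ofReal_mul (by positivity), ← ENNReal.ofReal_add (by positivity) (by positivity)]
              congr 1
              have hn1 : ((n - 1 : ℕ) : ℝ) = (n : ℝ) - 1 := by
                rw [Nat.cast_sub (by omega)]; simp
              rw [Real.mul_rpow (by norm_num) ht.le, Real.mul_rpow (by norm_num) ht.le]
              have e1 : t⁻¹ * t ^ ((n : ℝ) - 2 * s) = t ^ (n - 1) * t ^ (-(2 * s)) := by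
                rw [← Real.rpow_natCast, ← Real.rpow_neg_one, ← Real.rpow_add ht, ← Real.rpow_add ht, hn1]
                congr 1; ring
              have e2 : t ^ ((n : ℝ) - (2 * s + 1)) = t ^ (n - 1) * t ^ (-(2 * s)) := by
                rw [← Real.rpow_natCast, ← Real.rpow_add ht, hn1]
                congr 1; ring
              rw [e2]
              linear_combination (C₁ * 2 ^ ((n : ℝ) - 2 * s)) * e1
      · exact ((continuous_jap.rpow_const fun x => Or.inl (jap_pos x).ne').measurable.ennreal_ofReal).const_mul _
    have := htr.trans hb
    exact (ENNReal.mul_le_mul_iff_right (by simp; positivity) ENNReal.ofReal_ne_top).1 this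
  · intro ω
    have hω : ‖ω.1‖ = 1 := by simp
    have h1 := oneD (fun τ => jap (y + τ • ω.1) ^ (-(2 * s))) _ (fun τ => M (y + τ • ω.1)) t t ht
      (fun τ => jap_ray y ω.1 (-(2 * s)) τ) (hMc.comp (by fun_prop)) (jap_ray_cont y ω.1 _) ?_
    · refine h1.trans ?_
      calc _ = ∫⁻ τ in Ioc t (t + t), (closedBall y (2 * t)).indicator
            (fun x => ENNReal.ofReal (M x)) (y + τ • ω.1) := by
            refine setLIntegral_congr_fun measurableSet_Ioc fun τ hτ => ?_
            have : y + τ • ω.1 ∈ closedBall y (2 * t) := by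
              rw [mem_closedBall, dist_eq_norm, add_sub_cancel_left, norm_smul, hω, mul_one,
                Real.norm_of_nonneg (by linarith [hτ.1])]
              linarith [hτ.2]
            rw [indicator_of_mem this]
        _ ≤ _ := lintegral_mono_set (fun τ hτ => hτ.1)
    · intro τ hτ
      have hp := jap_pos (y + τ • ω.1)
      have := jap_ray_bound (y + τ • ω.1) ω.1 hω (-(2 * s))
      rw [abs_of_nonneg (Real.rpow_nonneg hp.le _), hM]
      rw [abs_neg, abs_of_nonneg (show 0 ≤ 2 * s by linarith)] at this
      have e : -(2 * s) - 1 = -(2 * s + 1) := by ring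
      rw [e] at this
      rw [e]
      simp only
      rw [div_eq_inv_mul]
      linarith

open LineDeriv in
/-- Sum of squares of all derivatives of order at most two. -/
def N2 {n : ℕ} (f : 𝓢(En n, ℂ)) (ξ : En n) : ℝ :=
  ‖f ξ‖ ^ 2 + ∑ a : Fin n, ‖(∂_{EuclideanSpace.single a (1 : ℝ)} f : 𝓢(En n, ℂ)) ξ‖ ^ 2 +
    ∑ a : Fin n, ∑ b : Fin n, ‖(∂_{EuclideanSpace.single a (1 : ℝ)} (∂_{EuclideanSpace.single b (1 : ℝ)} f : 𝓢(En n, ℂ)) :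
      𝓢(En n, ℂ)) ξ‖ ^ 2

lemma N2_nonneg {n : ℕ} (f : 𝓢(En n, ℂ)) (ξ : En n) : 0 ≤ N2 f ξ := by
  unfold N2; positivity

lemma N2_cont {n : ℕ} (f : 𝓢(En n, ℂ)) : Continuous (N2 f) := by
  unfold N2
  have : ∀ g : 𝓢(En n, ℂ), Continuous fun ξ => ‖g ξ‖ ^ 2 := fun g => g.continuous.norm.pow 2
  refine ((this _).add (continuous_finsetSum _ fun a _ => this _)).add
    (continuous_finsetSum _ fun a _ => continuous_finsetSum _ fun b _ => this _)

lemma cs_dir {n : ℕ} (ω : En n) (hω : ‖ω‖ = 1) (z : Fin n → ℂ) :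
    ‖∑ b, ω b • z b‖ ^ 2 ≤ ∑ b, ‖z b‖ ^ 2 := by
  have h1 : ‖∑ b, ω b • z b‖ ≤ ∑ b, |ω b| * ‖z b‖ := by
    refine (norm_sum_le _ _).trans (le_of_eq ?_)
    simp [norm_smul]
  have h2 : ∑ b, |ω b| ^ 2 = 1 := by
    have := EuclideanSpace.norm_sq_eq ω
    rw [hω] at this
    simpa using this.symm
  calc _ ≤ (∑ b, |ω b| * ‖z b‖) ^ 2 := by gcongr
    _ ≤ (∑ b, |ω b| ^ 2) * ∑ b, ‖z b‖ ^ 2 := Finset.sum_mul_sq_le_sq_mul_sq _ _ _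
    _ = _ := by rw [h2, one_mul]

open LineDeriv in
lemma dir_expand {n : ℕ} (f : 𝓢(En n, ℂ)) (ω : En n) :
    (∂_{ω} f : 𝓢(En n, ℂ)) = ∑ b, ω b • (∂_{EuclideanSpace.single b (1 : ℝ)} f : 𝓢(En n, ℂ)) := by
  have hexp : ω = ∑ b, ω b • EuclideanSpace.single b (1 : ℝ) := by
    have := (EuclideanSpace.basisFun (Fin n) ℝ).sum_repr ω
    simpa using this.symm
  conv_lhs => rw [hexp]
  rw [lineDerivOp_left_sum]
  refine Finset.sum_congr rfl fun b _ => ?_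
  rw [lineDerivOp_left_smul]

lemma N2_le0 {n : ℕ} (f : 𝓢(En n, ℂ)) (ξ : En n) : ‖f ξ‖ ^ 2 ≤ N2 f ξ := by
  unfold N2
  rw [add_assoc]
  exact le_add_of_nonneg_right (by positivity)

open LineDeriv in
lemma N2_le1 {n : ℕ} (f : 𝓢(En n, ℂ)) (ξ ω : En n) (hω : ‖ω‖ = 1) :
    ‖(∂_{ω} f : 𝓢(En n, ℂ)) ξ‖ ^ 2 ≤ N2 f ξ := by
  rw [dir_expand]
  have := cs_dir ω hω (fun b : Fin n => (∂_{EuclideanSpace.single b (1 : ℝ)} f : 𝓢(En n, ℂ)) ξ)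
  unfold N2
  simp only [sum_apply, smul_apply]
  refine this.trans ?_
  refine (le_add_of_nonneg_left (sq_nonneg _)).trans (le_add_of_nonneg_right ?_)
  exact Finset.sum_nonneg fun a _ => Finset.sum_nonneg fun b _ => sq_nonneg _

open LineDeriv in
lemma N2_le2 {n : ℕ} (f : 𝓢(En n, ℂ)) (ξ ω : En n) (hω : ‖ω‖ = 1) :
    ‖(∂_{ω} (∂_{ω} f : 𝓢(En n, ℂ)) : 𝓢(En n, ℂ)) ξ‖ ^ 2 ≤ N2 f ξ := by
  rw [dir_expand (∂_{ω} f : 𝓢(En n, ℂ))]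
  have := cs_dir ω hω (fun b : Fin n => (∂_{EuclideanSpace.single b (1 : ℝ)} (∂_{ω} f : 𝓢(En n, ℂ)) : 𝓢(En n, ℂ)) ξ)
  simp only [sum_apply, smul_apply]
  refine this.trans ?_
  unfold N2
  refine le_trans ?_ (le_add_of_nonneg_left (by positivity))
  refine Finset.sum_le_sum fun a _ => ?_
  rw [dir_expand f]
  have := cs_dir ω hω (fun b : Fin n => (∂_{EuclideanSpace.single a (1 : ℝ)}
    (∂_{EuclideanSpace.single b (1 : ℝ)} f : 𝓢(En n, ℂ)) : 𝓢(En n, ℂ)) ξ)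
  rw [lineDerivOp_sum]
  simp only [lineDerivOp_smul, sum_apply, smul_apply]
  exact this

lemma jap_rpow_temperate {n : ℕ} (β : ℝ) :
    (fun x : En n => jap x ^ β).HasTemperateGrowth := by
  have := Function.hasTemperateGrowth_one_add_norm_sq_rpow (En n) (β / 2)
  have e : (fun x : En n => jap x ^ β) = fun x : En n => (1 + ‖x‖ ^ 2) ^ (β / 2) := by
    ext x
    unfold jap
    rw [Real.sqrt_eq_rpow, ← Real.rpow_mul (by positivity)]
    congr 1; ring
  rw [e]
  exact this

lemma planch {n : ℕ} (g u : 𝓢(En n, ℂ)) (K : ℝ)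
    (h : ∀ x, ‖g x‖ ≤ K * (jap x ^ 2 * ‖u x‖)) :
    ∫⁻ ξ, ENNReal.ofReal (‖(𝓕 g : 𝓢(En n, ℂ)) ξ‖ ^ 2) ≤
      ENNReal.ofReal (K ^ 2 * ∫ x, jap x ^ (2 * (2 : ℝ)) * ‖u x‖ ^ 2) := by
  have hIntg : ∀ g : 𝓢(En n, ℂ), Integrable (fun x => ‖g x‖ ^ 2) := by
    intro g
    exact (memLp_two_iff_integrable_sq_norm g.continuous.aestronglyMeasurable).1 (g.memLp 2)
  rw [← ofReal_integral_eq_lintegral_ofReal (hIntg _) (Eventually.of_forall fun x => by positivity),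
    SchwartzMap.integral_norm_sq_fourier]
  apply ENNReal.ofReal_le_ofReal
  rw [← integral_const_mul]
  set w : 𝓢(En n, ℂ) := SchwartzMap.smulLeftCLM ℂ (fun x : En n => jap x ^ (2 : ℝ)) u with hw
  have hwx : ∀ x, ‖w x‖ ^ 2 = jap x ^ (2 * (2 : ℝ)) * ‖u x‖ ^ 2 := by
    intro x
    rw [hw, SchwartzMap.smulLeftCLM_apply_apply (jap_rpow_temperate 2), norm_smul, mul_pow,
      Real.norm_of_nonneg (Real.rpow_nonneg (jap_pos x).le _), mul_comm 2 (2 : ℝ),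
      Real.rpow_mul (jap_pos x).le, Real.rpow_two, Real.rpow_two]
  refine integral_mono (hIntg g) ?_ fun x => ?_
  · simp_rw [← hwx]
    exact (hIntg w).const_mul _
  · have h1 := h x
    have e : jap x ^ (2 * (2 : ℝ)) = (jap x ^ 2) ^ 2 := by
      rw [Real.rpow_mul (jap_pos x).le, Real.rpow_two, Real.rpow_two]
    simp only
    rw [e, ← mul_pow, ← mul_pow]
    exact pow_le_pow_left₀ (norm_nonneg _) h1 2

open LineDeriv in
lemma sobolev_N2 (n : ℕ) : ∃ C : ℝ, 0 ≤ C ∧ ∀ f : 𝓢(En n, ℂ),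
    ∫⁻ ξ, ENNReal.ofReal (N2 f ξ) ≤
      ENNReal.ofReal (C * ∫ x, jap x ^ (2 * (2 : ℝ)) * ‖(𝓕⁻ f : 𝓢(En n, ℂ)) x‖ ^ 2) := by
  refine ⟨1 ^ 2 + n * (2 * π) ^ 2 + n * (n * ((2 * π) ^ 2) ^ 2), by positivity, fun f => ?_⟩
  set u : 𝓢(En n, ℂ) := 𝓕⁻ f with hu
  have hf : f = 𝓕 u := by rw [hu, FourierTransform.fourier_fourierInv_eq]
  set I := ∫ x, jap x ^ (2 * (2 : ℝ)) * ‖u x‖ ^ 2 with hI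
  have hI0 : 0 ≤ I := integral_nonneg fun x => by
    have := jap_pos x
    positivity
  have hcoord : ∀ (a : Fin n) (x : En n), |⟪x, EuclideanSpace.single a (1 : ℝ)⟫| ≤ jap x := by
    intro a x
    refine (abs_real_inner_le_norm _ _).trans ?_
    simpa using norm_le_jap x
  have htg : ∀ a : Fin n, (fun x : En n => ⟪x, EuclideanSpace.single a (1 : ℝ)⟫).HasTemperateGrowth := by
    intro a; fun_prop
  have hj2 : ∀ x : En n, jap x ≤ jap x ^ 2 := fun x => by nlinarith [one_le_jap x]
  have hmul : ∀ (g : 𝓢(En n, ℂ)) (a : Fin n) (x : En n),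
      ‖(-(2 * π * Complex.I) • SchwartzMap.smulLeftCLM ℂ (inner ℝ · (EuclideanSpace.single a (1 : ℝ))) g
        : 𝓢(En n, ℂ)) x‖ ≤ 2 * π * (jap x * ‖g x‖) := by
    intro g a x
    rw [smul_apply, SchwartzMap.smulLeftCLM_apply_apply (htg a), norm_smul, norm_smul]
    have : ‖(-(2 * π * Complex.I) : ℂ)‖ = 2 * π := by simp [abs_of_pos pi_pos]
    rw [this]
    gcongr
    exact hcoord a x
  have h0 : ∫⁻ ξ, ENNReal.ofReal (‖f ξ‖ ^ 2) ≤ ENNReal.ofReal (1 ^ 2 * I) := by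
    rw [hf]
    refine planch u u 1 fun x => ?_
    rw [one_mul]
    refine le_mul_of_one_le_left (norm_nonneg _) ?_
    nlinarith [one_le_jap x]
  have h1 : ∀ a : Fin n, ∫⁻ ξ, ENNReal.ofReal (‖(∂_{EuclideanSpace.single a (1 : ℝ)} f : 𝓢(En n, ℂ)) ξ‖ ^ 2) ≤
      ENNReal.ofReal ((2 * π) ^ 2 * I) := by
    intro a
    rw [hf, SchwartzMap.lineDerivOp_fourier_eq]
    refine planch _ u (2 * π) fun x => (hmul u a x).trans ?_
    gcongr
    exact hj2 x
  have h2 : ∀ a b : Fin n, ∫⁻ ξ, ENNReal.ofReal (‖(∂_{EuclideanSpace.single a (1 : ℝ)}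
      (∂_{EuclideanSpace.single b (1 : ℝ)} f : 𝓢(En n, ℂ)) : 𝓢(En n, ℂ)) ξ‖ ^ 2) ≤
      ENNReal.ofReal (((2 * π) ^ 2) ^ 2 * I) := by
    intro a b
    rw [hf, SchwartzMap.lineDerivOp_fourier_eq, SchwartzMap.lineDerivOp_fourier_eq]
    refine planch _ u ((2 * π) ^ 2) fun x => (hmul _ a x).trans ?_
    have hj := jap_pos x
    calc _ ≤ 2 * π * (jap x * (2 * π * (jap x * ‖u x‖))) := by
          gcongr
          exact hmul u b x
      _ = _ := by ring
  have hm : ∀ g : 𝓢(En n, ℂ), Measurable fun ξ => ENNReal.ofReal (‖g ξ‖ ^ 2) := fun g =>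
    (g.continuous.norm.pow 2).measurable.ennreal_ofReal
  have hsplit : ∀ ξ, ENNReal.ofReal (N2 f ξ) = ENNReal.ofReal (‖f ξ‖ ^ 2) +
      ∑ a : Fin n, ENNReal.ofReal (‖(∂_{EuclideanSpace.single a (1 : ℝ)} f : 𝓢(En n, ℂ)) ξ‖ ^ 2) +
      ∑ a : Fin n, ∑ b : Fin n, ENNReal.ofReal (‖(∂_{EuclideanSpace.single a (1 : ℝ)}
      (∂_{EuclideanSpace.single b (1 : ℝ)} f : 𝓢(En n, ℂ)) : 𝓢(En n, ℂ)) ξ‖ ^ 2) := by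
    intro ξ
    unfold N2
    rw [ENNReal.ofReal_add (by positivity) (by positivity), ENNReal.ofReal_add (by positivity) (by positivity),
      ENNReal.ofReal_sum_of_nonneg (fun _ _ => by positivity),
      ENNReal.ofReal_sum_of_nonneg (fun _ _ => by positivity)]
    congr 1
    refine Finset.sum_congr rfl fun a _ => ?_
    rw [ENNReal.ofReal_sum_of_nonneg (fun _ _ => by positivity)]
  simp_rw [hsplit]
  rw [lintegral_add_right _ (Finset.measurable_fun_sum _ fun a _ =>
      Finset.measurable_fun_sum _ fun b _ => hm _), lintegral_add_left (hm _),
    lintegral_finsetSum _ (fun a _ => hm _),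
    lintegral_finsetSum _ (fun a _ => Finset.measurable_fun_sum _ fun b _ => hm _)]
  simp_rw [lintegral_finsetSum _ (fun b _ => hm _)]
  rw [add_mul, add_mul, ENNReal.ofReal_add (by positivity) (by positivity),
    ENNReal.ofReal_add (by positivity) (by positivity)]
  refine add_le_add (add_le_add h0 ?_) ?_
  · refine (Finset.sum_le_sum fun a _ => h1 a).trans ?_
    rw [Finset.sum_const, Finset.card_univ, Fintype.card_fin, nsmul_eq_mul, mul_assoc,
      ENNReal.ofReal_mul (p := (n : ℝ)) (by positivity), ENNReal.ofReal_natCast]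
  · refine (Finset.sum_le_sum fun a _ => Finset.sum_le_sum fun b _ => h2 a b).trans ?_
    simp only [Finset.sum_const, Finset.card_univ, Fintype.card_fin, nsmul_eq_mul]
    rw [mul_assoc, mul_assoc, ENNReal.ofReal_mul (p := (n : ℝ)) (by positivity), ENNReal.ofReal_natCast,
      ENNReal.ofReal_mul (p := (n : ℝ)) (by positivity), ENNReal.ofReal_natCast]

open LineDeriv in
def ph0 {n : ℕ} (f : 𝓢(En n, ℂ)) (η ξ : En n) : ℂ := f ξ * f (η - ξ)

open LineDeriv in
def ph1 {n : ℕ} (f : 𝓢(En n, ℂ)) (η ω ξ : En n) : ℂ :=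
  (∂_{ω} f : 𝓢(En n, ℂ)) ξ * f (η - ξ) - f ξ * (∂_{ω} f : 𝓢(En n, ℂ)) (η - ξ)

open LineDeriv in
def ph2 {n : ℕ} (f : 𝓢(En n, ℂ)) (η ω ξ : En n) : ℂ :=
  (∂_{ω} (∂_{ω} f : 𝓢(En n, ℂ)) : 𝓢(En n, ℂ)) ξ * f (η - ξ)
    - 2 * ((∂_{ω} f : 𝓢(En n, ℂ)) ξ * (∂_{ω} f : 𝓢(En n, ℂ)) (η - ξ))
    + f ξ * (∂_{ω} (∂_{ω} f : 𝓢(En n, ℂ)) : 𝓢(En n, ℂ)) (η - ξ)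

open LineDeriv in
lemma ray_deriv {n : ℕ} (g : 𝓢(En n, ℂ)) (c ω : En n) (τ : ℝ) :
    HasDerivAt (fun τ : ℝ => g (c + τ • ω)) ((∂_{ω} g : 𝓢(En n, ℂ)) (c + τ • ω)) τ := by
  have h0 : HasDerivAt (fun τ : ℝ => c + τ • ω) ω τ := by
    simpa using ((hasDerivAt_id τ).smul_const ω).const_add c
  exact (g.hasFDerivAt (c + τ • ω)).comp_hasDerivAt τ h0

open LineDeriv in
lemma ray_deriv' {n : ℕ} (g : 𝓢(En n, ℂ)) (η c ω : En n) (τ : ℝ) :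
    HasDerivAt (fun τ : ℝ => g (η - (c + τ • ω))) (-(∂_{ω} g : 𝓢(En n, ℂ)) (η - (c + τ • ω))) τ := by
  have h0 : HasDerivAt (fun τ : ℝ => η - (c + τ • ω)) (-ω) τ := by
    simpa using (((hasDerivAt_id τ).smul_const ω).const_add c).const_sub η
  refine ((g.hasFDerivAt (η - (c + τ • ω))).comp_hasDerivAt τ h0).congr_deriv ?_
  rw [map_neg]; rfl

lemma ph0_ray {n : ℕ} (f : 𝓢(En n, ℂ)) (η c ω : En n) (τ : ℝ) :
    HasDerivAt (fun τ : ℝ => ph0 f η (c + τ • ω)) (ph1 f η ω (c + τ • ω)) τ := by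
  refine ((ray_deriv f c ω τ).mul (ray_deriv' f η c ω τ)).congr_deriv ?_
  unfold ph1; ring

open LineDeriv in
lemma ph1_ray {n : ℕ} (f : 𝓢(En n, ℂ)) (η c ω : En n) (τ : ℝ) :
    HasDerivAt (fun τ : ℝ => ph1 f η ω (c + τ • ω)) (ph2 f η ω (c + τ • ω)) τ := by
  refine (((ray_deriv (∂_{ω} f : 𝓢(En n, ℂ)) c ω τ).mul (ray_deriv' f η c ω τ)).sub
    ((ray_deriv f c ω τ).mul (ray_deriv' (∂_{ω} f : 𝓢(En n, ℂ)) η c ω τ))).congr_deriv ?_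
  unfold ph2; ring

lemma ph2_cont {n : ℕ} (f : 𝓢(En n, ℂ)) (η c ω : En n) :
    Continuous (fun τ : ℝ => ph2 f η ω (c + τ • ω)) := by
  unfold ph2
  have h1 : ∀ g : 𝓢(En n, ℂ), Continuous fun τ : ℝ => g (c + τ • ω) := fun g =>
    g.continuous.comp (by fun_prop)
  have h2 : ∀ g : 𝓢(En n, ℂ), Continuous fun τ : ℝ => g (η - (c + τ • ω)) := fun g =>
    g.continuous.comp (by fun_prop)
  exact (((h1 _).mul (h2 _)).sub (continuous_const.mul ((h1 _).mul (h2 _)))).add ((h1 _).mul (h2 _))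

lemma sq_mul_le {a b A B : ℝ} (ha : a ^ 2 ≤ A) (hb : b ^ 2 ≤ B) : (a * b) ^ 2 ≤ A * B := by
  rw [mul_pow]
  exact mul_le_mul ha hb (sq_nonneg _) ((sq_nonneg _).trans ha)

lemma ph0_le {n : ℕ} (f : 𝓢(En n, ℂ)) (η ξ : En n) :
    ‖ph0 f η ξ‖ ^ 2 ≤ N2 f ξ * N2 f (η - ξ) := by
  unfold ph0
  rw [norm_mul]
  exact sq_mul_le (N2_le0 f ξ) (N2_le0 f _)

lemma ph1_le {n : ℕ} (f : 𝓢(En n, ℂ)) (η ω ξ : En n) (hω : ‖ω‖ = 1) :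
    ‖ph1 f η ω ξ‖ ^ 2 ≤ 4 * (N2 f ξ * N2 f (η - ξ)) := by
  unfold ph1
  have h1 := sq_mul_le (N2_le1 f ξ ω hω) (N2_le0 f (η - ξ))
  have h2 := sq_mul_le (N2_le0 f ξ) (N2_le1 f (η - ξ) ω hω)
  rw [← norm_mul] at h1 h2
  refine (pow_le_pow_left₀ (norm_nonneg _) (norm_sub_le _ _) 2).trans ?_
  refine (add_sq_le).trans ?_
  linarith

lemma three_sq {x y z K : ℝ} (h1 : x ^ 2 ≤ K) (h2 : y ^ 2 ≤ K) (h3 : z ^ 2 ≤ K) :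
    (x + 2 * y + z) ^ 2 ≤ 18 * K := by
  nlinarith [sq_nonneg (x - 2 * y), sq_nonneg (2 * y - z), sq_nonneg (x - z)]

lemma ph2_le {n : ℕ} (f : 𝓢(En n, ℂ)) (η ω ξ : En n) (hω : ‖ω‖ = 1) :
    ‖ph2 f η ω ξ‖ ^ 2 ≤ 18 * (N2 f ξ * N2 f (η - ξ)) := by
  unfold ph2
  have h1 := sq_mul_le (N2_le2 f ξ ω hω) (N2_le0 f (η - ξ))
  have h2 := sq_mul_le (N2_le1 f ξ ω hω) (N2_le1 f (η - ξ) ω hω)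
  have h3 := sq_mul_le (N2_le0 f ξ) (N2_le2 f (η - ξ) ω hω)
  rw [← norm_mul] at h1 h2 h3
  refine (pow_le_pow_left₀ (norm_nonneg _) ((norm_add_le _ _).trans
    (add_le_add_left (norm_sub_le _ _) _)) 2).trans ?_
  rw [norm_mul (2 : ℂ), Complex.norm_ofNat]
  exact three_sq h1 h2 h3

lemma trace_Phi {n : ℕ} (hn : 2 ≤ n) (f : 𝓢(En n, ℂ)) (η c : En n) (t : ℝ) (ht : 0 < t) :
    ENNReal.ofReal (t ^ (n - 1)) * ∫⁻ ω : sphere (0 : En n) 1,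
      ENNReal.ofReal (‖ph0 f η (c + t • ω.1)‖ ^ 2 + ‖ph1 f η ω.1 (c + t • ω.1)‖ ^ 2)
        ∂((volume : Measure (En n)).toSphere) ≤
      ∫⁻ ξ, ENNReal.ofReal (32 * (N2 f ξ * N2 f (η - ξ))) := by
  have hFc : Continuous (fun ξ => 32 * (N2 f ξ * N2 f (η - ξ))) :=
    continuous_const.mul ((N2_cont f).mul ((N2_cont f).comp (by fun_prop)))
  refine trace_ineq hn _ hFc.measurable.ennreal_ofReal c t ht _ fun ω => ?_
  have hω : ‖ω.1‖ = 1 := by simp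
  have h1 := oneD (fun τ => ‖ph0 f η (c + τ • ω.1)‖ ^ 2 + ‖ph1 f η ω.1 (c + τ • ω.1)‖ ^ 2) _
    (fun τ => 32 * (N2 f (c + τ • ω.1) * N2 f (η - (c + τ • ω.1)))) t 1 one_pos
    (fun τ => (ph0_ray f η c ω.1 τ).norm_sq.add (ph1_ray f η c ω.1 τ).norm_sq)
    (hFc.comp (by fun_prop)) ?_ ?_
  · exact h1.trans (lintegral_mono_set (fun τ hτ => hτ.1))
  · have c0 : Continuous (fun τ : ℝ => ph0 f η (c + τ • ω.1)) :=
      continuous_iff_continuousAt.2 fun τ => (ph0_ray f η c ω.1 τ).continuousAt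
    have c1 : Continuous (fun τ : ℝ => ph1 f η ω.1 (c + τ • ω.1)) :=
      continuous_iff_continuousAt.2 fun τ => (ph1_ray f η c ω.1 τ).continuousAt
    exact (continuous_const.mul (c0.inner c1)).add (continuous_const.mul (c1.inner (ph2_cont f η c ω.1)))
  · intro τ _
    have e0 := ph0_le f η (c + τ • ω.1)
    have e1 := ph1_le f η ω.1 (c + τ • ω.1) hω
    have e2 := ph2_le f η ω.1 (c + τ • ω.1) hω
    set z0 := ph0 f η (c + τ • ω.1)
    set z1 := ph1 f η ω.1 (c + τ • ω.1)
    set z2 := ph2 f η ω.1 (c + τ • ω.1)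
    have i0 := abs_real_inner_le_norm z0 z1
    have i1 := abs_real_inner_le_norm z1 z2
    rw [div_one, abs_of_nonneg (by positivity)]
    have i2 : |2 * ⟪z0, z1⟫ + 2 * ⟪z1, z2⟫| ≤ 2 * (‖z0‖ * ‖z1‖) + 2 * (‖z1‖ * ‖z2‖) := by
      refine (abs_add_le _ _).trans ?_
      rw [abs_mul, abs_mul, abs_two]
      linarith
    nlinarith [sq_nonneg (‖z0‖ - ‖z1‖), sq_nonneg (‖z1‖ - ‖z2‖)]

def wt {n : ℕ} (β : ℝ) (η ξ : En n) : ℝ := jap ξ ^ (-β) * jap (η - ξ) ^ (-β)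

lemma wt_nonneg {n : ℕ} (β : ℝ) (η ξ : En n) : 0 ≤ wt β η ξ :=
  mul_nonneg (Real.rpow_nonneg (jap_pos _).le _) (Real.rpow_nonneg (jap_pos _).le _)

lemma jap_tri {n : ℕ} (η ξ : En n) : jap η ≤ jap ξ + jap (η - ξ) := by
  have h1 := jap_pos ξ
  have h2 := jap_pos (η - ξ)
  have h3 : ‖η‖ ≤ ‖ξ‖ + ‖η - ξ‖ := by
    have := norm_add_le ξ (η - ξ)
    simpa using this
  refine (pow_le_pow_iff_left₀ (jap_pos η).le (by positivity) two_ne_zero).1 ?_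
  nlinarith [jap_sq η, jap_sq ξ, jap_sq (η - ξ), norm_nonneg η, norm_nonneg ξ, norm_nonneg (η - ξ),
    mul_le_mul (norm_le_jap ξ) (norm_le_jap (η - ξ)) (norm_nonneg _) h1.le]

lemma half_wt {x y z β s : ℝ} (hx : 1 ≤ x) (hy : 0 < y) (hz : 0 < z) (hsβ : s ≤ β)
    (hβ : 0 ≤ β) (h : z ≤ 2 * y) :
    (x ^ (-β) * y ^ (-β)) ^ 2 ≤ 2 ^ (2 * β) * z ^ (-(2 * β)) * x ^ (-(2 * s)) := by
  have hx0 : 0 < x := by linarith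
  have e1 : (x ^ (-β)) ^ 2 = x ^ (-(2 * β)) := by
    rw [← Real.rpow_natCast, ← Real.rpow_mul hx0.le]; congr 1; push_cast; ring
  have e2 : (y ^ (-β)) ^ 2 = y ^ (-(2 * β)) := by
    rw [← Real.rpow_natCast, ← Real.rpow_mul hy.le]; congr 1; push_cast; ring
  have h1 : x ^ (-(2 * β)) ≤ x ^ (-(2 * s)) := Real.rpow_le_rpow_of_exponent_le hx (by linarith)
  have h2 : y ^ (-(2 * β)) ≤ 2 ^ (2 * β) * z ^ (-(2 * β)) := by
    have h3 : y ^ (-(2 * β)) ≤ (z / 2) ^ (-(2 * β)) :=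
      Real.rpow_le_rpow_of_nonpos (by linarith) (by linarith) (by linarith)
    refine h3.trans (le_of_eq ?_)
    rw [Real.div_rpow hz.le (by norm_num), Real.rpow_neg (by norm_num : (0 : ℝ) ≤ 2)]
    field_simp
  rw [mul_pow, e1, e2, mul_comm]
  exact mul_le_mul h2 h1 (by positivity) (by positivity)

lemma wt_sq {n : ℕ} (β s : ℝ) (hβ : 0 ≤ β) (hsβ : s ≤ β) (η ξ : En n) :
    wt β η ξ ^ 2 ≤ 2 ^ (2 * β) * jap η ^ (-(2 * β)) * (jap ξ ^ (-(2 * s)) + jap (η - ξ) ^ (-(2 * s))) := by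
  have h1 := jap_pos ξ
  have h2 := jap_pos (η - ξ)
  have h0 := jap_pos η
  have ht := jap_tri η ξ
  unfold wt
  rw [mul_add]
  rcases le_total (jap ξ) (jap (η - ξ)) with h | h
  · refine (half_wt (one_le_jap ξ) h2 h0 hsβ hβ (by linarith)).trans ?_
    exact le_add_of_nonneg_right (by positivity)
  · rw [mul_comm (jap ξ ^ (-β))]
    refine (half_wt (one_le_jap (η - ξ)) h1 h0 hsβ hβ (by linarith)).trans ?_
    exact le_add_of_nonneg_left (by positivity)

lemma ph_bound {n : ℕ} (β : ℝ) (hβ : 0 ≤ β) (f Q : 𝓢(En n, ℂ))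
    (hf : ∀ ξ, f ξ = (jap ξ ^ β : ℝ) • Q ξ) (η ω ξ : En n) (hω : ‖ω‖ = 1) :
    ‖ph0 Q η ξ‖ + ‖ph1 Q η ω ξ‖ ≤ wt β η ξ * ((1 + 2 * β) * ‖ph0 f η ξ‖ + ‖ph1 f η ω ξ‖) := by
  have h0 : ∀ ξ, ph0 Q η ξ = (wt β η ξ) • ph0 f η ξ := by
    intro ξ
    have hQ : ∀ x, Q x = (jap x ^ (-β)) • f x := by
      intro x
      rw [hf x, smul_smul, ← Real.rpow_add (jap_pos x), neg_add_cancel, Real.rpow_zero, one_smul]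
    unfold ph0 wt
    rw [hQ ξ, hQ (η - ξ), smul_mul_smul_comm]
  have ej := jap_ray ξ ω (-β) 0
  have ej' := jap_ray (η - ξ) (-ω) (-β) 0
  have bj := jap_ray_bound (ξ + (0 : ℝ) • ω) ω hω (-β)
  have bj' := jap_ray_bound ((η - ξ) + (0 : ℝ) • (-ω)) (-ω) (by rw [norm_neg, hω]) (-β)
  set d1 := ⟪ξ + (0 : ℝ) • ω, ω⟫ / jap (ξ + (0 : ℝ) • ω) * (-β * jap (ξ + (0 : ℝ) • ω) ^ (-β - 1)) with hd1
  set d2 := ⟪(η - ξ) + (0 : ℝ) • (-ω), -ω⟫ / jap ((η - ξ) + (0 : ℝ) • (-ω)) *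
    (-β * jap ((η - ξ) + (0 : ℝ) • (-ω)) ^ (-β - 1)) with hd2
  have ep := ph0_ray f η ξ ω 0
  have eP := ph0_ray Q η ξ ω 0
  have e2 := (ej.mul ej').smul ep
  have efun : ∀ τ : ℝ, ph0 Q η (ξ + τ • ω) =
      (jap (ξ + τ • ω) ^ (-β) * jap (η - ξ + τ • (-ω)) ^ (-β)) • ph0 f η (ξ + τ • ω) := by
    intro τ
    rw [h0]
    unfold wt
    have : η - ξ + τ • (-ω) = η - (ξ + τ • ω) := by rw [smul_neg]; abel
    rw [this]
  have e3 : HasDerivAt (fun τ : ℝ => ph0 Q η (ξ + τ • ω)) _ 0 :=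
    e2.congr_of_eventuallyEq (Eventually.of_forall efun)
  have eu := eP.unique e3
  simp only [zero_smul, add_zero, Pi.mul_apply] at eu bj bj'
  have hd1' : |d1| ≤ β * jap ξ ^ (-β) := by
    refine le_trans bj ?_
    rw [abs_neg, abs_of_nonneg hβ]
    gcongr
    · exact one_le_jap ξ
    · linarith
  have hd2' : |d2| ≤ β * jap (η - ξ) ^ (-β) := by
    refine le_trans bj' ?_
    rw [abs_neg, abs_of_nonneg hβ]
    gcongr
    · exact one_le_jap (η - ξ)
    · linarith
  clear_value d1 d2
  have p1 : 0 ≤ jap ξ ^ (-β) := Real.rpow_nonneg (jap_pos _).le _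
  have p2 : 0 ≤ jap (η - ξ) ^ (-β) := Real.rpow_nonneg (jap_pos _).le _
  have hn1 : ‖ph1 Q η ω ξ‖ ≤ wt β η ξ * ‖ph1 f η ω ξ‖ + 2 * β * wt β η ξ * ‖ph0 f η ξ‖ := by
    rw [eu]
    refine (norm_add_le _ _).trans ?_
    rw [norm_smul, norm_smul, Real.norm_of_nonneg (mul_nonneg p1 p2)]
    refine add_le_add le_rfl ?_
    refine mul_le_mul_of_nonneg_right ?_ (norm_nonneg _)
    refine (norm_add_le _ _).trans ?_
    rw [norm_mul, norm_mul, Real.norm_eq_abs, Real.norm_eq_abs, Real.norm_eq_abs, Real.norm_eq_abs,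
      abs_of_nonneg p1, abs_of_nonneg p2]
    unfold wt
    nlinarith [mul_le_mul_of_nonneg_right hd1' p2, mul_le_mul_of_nonneg_left hd2' p1]
  have hn0 : ‖ph0 Q η ξ‖ = wt β η ξ * ‖ph0 f η ξ‖ := by
    rw [h0, norm_smul, Real.norm_of_nonneg (wt_nonneg β η ξ)]
  rw [hn0]
  nlinarith

open LineDeriv in
lemma ph1_cont_ω {n : ℕ} (f : 𝓢(En n, ℂ)) (η c : En n) (t : ℝ) :
    Continuous (fun ω : En n => ph1 f η ω (c + t • ω)) := by
  unfold ph1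
  have hd : Continuous (fderiv ℝ f) := (SchwartzMap.fderivCLM ℝ (En n) ℂ f).continuous
  have h1 : Continuous fun ω : En n => (∂_{ω} f : 𝓢(En n, ℂ)) (c + t • ω) :=
    (hd.comp (by fun_prop : Continuous fun ω : En n => c + t • ω)).clm_apply continuous_id
  have h2 : Continuous fun ω : En n => (∂_{ω} f : 𝓢(En n, ℂ)) (η - (c + t • ω)) :=
    (hd.comp (by fun_prop : Continuous fun ω : En n => η - (c + t • ω))).clm_apply continuous_id
  exact (h1.mul (f.continuous.comp (by fun_prop))).sub ((f.continuous.comp (by fun_prop)).mul h2)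

lemma ph0_cont {n : ℕ} (f : 𝓢(En n, ℂ)) (η : En n) : Continuous (ph0 f η) := by
  unfold ph0
  exact f.continuous.mul (f.continuous.comp (by fun_prop))

lemma wt_cont {n : ℕ} (β : ℝ) (η : En n) : Continuous (wt β η) := by
  unfold wt
  exact (continuous_jap.rpow_const fun x => Or.inl (jap_pos x).ne').mul
    ((continuous_jap.comp (by fun_prop)).rpow_const fun x => Or.inl (jap_pos _).ne')

lemma cs_lintegral {X : Type*} [MeasurableSpace X] (μ : Measure X) (u v : X → ℝ) (hu : Measurable u)
    (hv : Measurable v) (hu0 : ∀ x, 0 ≤ u x) (hv0 : ∀ x, 0 ≤ v x) :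
    (∫⁻ x, ENNReal.ofReal (u x * v x) ∂μ) ^ 2 ≤
      (∫⁻ x, ENNReal.ofReal (u x ^ 2) ∂μ) * ∫⁻ x, ENNReal.ofReal (v x ^ 2) ∂μ := by
  have h := ENNReal.lintegral_mul_le_Lp_mul_Lq μ Real.HolderConjugate.two_two
    hu.ennreal_ofReal.aemeasurable hv.ennreal_ofReal.aemeasurable
  have e : ∀ w : X → ℝ, (∀ x, 0 ≤ w x) → ∀ x, ENNReal.ofReal (w x) ^ (2 : ℝ) = ENNReal.ofReal (w x ^ 2) := by
    intro w hw x
    rw [ENNReal.rpow_two, ENNReal.ofReal_pow (hw x)]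
  simp only [Pi.mul_apply, e u hu0, e v hv0] at h
  have e2 : ∀ z : ℝ≥0∞, (z ^ (1 / 2 : ℝ)) ^ 2 = z := by
    intro z
    rw [← ENNReal.rpow_two, ← ENNReal.rpow_mul]; norm_num
  calc _ = (∫⁻ x, ENNReal.ofReal (u x) * ENNReal.ofReal (v x) ∂μ) ^ 2 := by
        congr 1
        refine lintegral_congr fun x => ?_
        rw [ENNReal.ofReal_mul (hu0 x)]
    _ ≤ _ := pow_le_pow_left₀ (zero_le) h 2
    _ = _ := by rw [mul_pow, e2, e2]

/-- `T(η) = ∫ N2(ξ) N2(η-ξ) dξ`. -/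
def TT {n : ℕ} (f : 𝓢(En n, ℂ)) (η : En n) : ℝ≥0∞ :=
  ∫⁻ ξ, ENNReal.ofReal (N2 f ξ * N2 f (η - ξ))

lemma wt_int {n : ℕ} (hn : 2 ≤ n) (β s : ℝ) (hβ : 0 ≤ β) (hs : 0 ≤ s) (hsβ : s ≤ β)
    (hsn : 2 * s < (n : ℝ) - 1) :
    ∃ C : ℝ, 0 ≤ C ∧ ∀ (η c : En n) (t : ℝ), 0 < t →
      ∫⁻ ω : sphere (0 : En n) 1, ENNReal.ofReal (wt β η (c + t • ω.1) ^ 2)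
        ∂((volume : Measure (En n)).toSphere) ≤
        ENNReal.ofReal (C * jap η ^ (-(2 * β)) * t ^ (-(2 * s))) := by
  obtain ⟨C, hC, h⟩ := sphere_pow hn s hs hsn
  refine ⟨2 ^ (2 * β) * (C + C), by positivity, fun η c t ht => ?_⟩
  have h1 := h c t ht
  have h2 := h (c - η) t ht
  have hη := jap_pos η
  have hneg : ∀ ω : En n, jap (c - η + t • ω) = jap (η - (c + t • ω)) := by
    intro ω
    unfold jap
    rw [← norm_neg]; congr 4; abel
  simp_rw [hneg] at h2
  calc _ ≤ ∫⁻ ω : sphere (0 : En n) 1, ENNReal.ofReal (2 ^ (2 * β) * jap η ^ (-(2 * β))) *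
        (ENNReal.ofReal (jap (c + t • ω.1) ^ (-(2 * s))) +
          ENNReal.ofReal (jap (η - (c + t • ω.1)) ^ (-(2 * s))))
        ∂((volume : Measure (En n)).toSphere) := by
        refine lintegral_mono fun ω => ?_
        have p1 := jap_pos (c + t • ω.1)
        have p2 := jap_pos (η - (c + t • ω.1))
        rw [← ENNReal.ofReal_add (by positivity) (by positivity), ← ENNReal.ofReal_mul (by positivity)]
        exact ENNReal.ofReal_le_ofReal (wt_sq β s hβ hsβ η _)
    _ = ENNReal.ofReal (2 ^ (2 * β) * jap η ^ (-(2 * β))) *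
        ((∫⁻ ω : sphere (0 : En n) 1, ENNReal.ofReal (jap (c + t • ω.1) ^ (-(2 * s)))
          ∂((volume : Measure (En n)).toSphere)) +
        ∫⁻ ω : sphere (0 : En n) 1, ENNReal.ofReal (jap (η - (c + t • ω.1)) ^ (-(2 * s)))
          ∂((volume : Measure (En n)).toSphere)) := by
        rw [lintegral_const_mul' _ _ ENNReal.ofReal_ne_top, lintegral_add_left]
        have : Continuous fun ω : sphere (0 : En n) 1 => jap (c + t • ω.1) ^ (-(2 * s)) :=
          (continuous_jap.comp (by fun_prop)).rpow_const fun x => Or.inl (jap_pos _).ne'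
        exact this.measurable.ennreal_ofReal
    _ ≤ ENNReal.ofReal (2 ^ (2 * β) * jap η ^ (-(2 * β))) *
        (ENNReal.ofReal (C * t ^ (-(2 * s))) + ENNReal.ofReal (C * t ^ (-(2 * s)))) := by
        gcongr
    _ = _ := by
        rw [← ENNReal.ofReal_add (by positivity) (by positivity), ← ENNReal.ofReal_mul (by positivity)]
        congr 1; ring

lemma sphere_A {n : ℕ} (hn : 2 ≤ n) (β s : ℝ) (hβ : 0 ≤ β) (hs : 0 ≤ s) (hsβ : s ≤ β)
    (hsn : 2 * s < (n : ℝ) - 1) :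
    ∃ C : ℝ, 0 ≤ C ∧ ∀ (f Q : 𝓢(En n, ℂ)), (∀ ξ, f ξ = (jap ξ ^ β : ℝ) • Q ξ) →
      ∀ (η c : En n) (t : ℝ), 0 < t →
      (∫⁻ ω in sphere (0 : En n) 1, ENNReal.ofReal (‖ph0 Q η (c + t • ω)‖ + ‖ph1 Q η ω (c + t • ω)‖)
        ∂(μH[(n : ℝ) - 1])) ^ 2 ≤
        ENNReal.ofReal (C * jap η ^ (-(2 * β)) * t ^ (-(2 * s)) * (t ^ (n - 1))⁻¹) * TT f η := by
  obtain ⟨C₁, hC₁, h₁⟩ := wt_int hn β s hβ hs hsβ hsn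
  obtain ⟨C₂, hC₂, h₂⟩ := hausdorff_dom hn
  refine ⟨C₂.toReal ^ 2 * (C₁ * (2 * (1 + 2 * β) ^ 2 * 32)), by positivity, fun f Q hf η c t ht => ?_⟩
  set σ := (volume : Measure (En n)).toSphere with hσ
  have hη := jap_pos η
  have hmeas : Measurable fun ω : En n =>
      ENNReal.ofReal (‖ph0 Q η (c + t • ω)‖ + ‖ph1 Q η ω (c + t • ω)‖) :=
    (((ph0_cont Q η).comp (by fun_prop : Continuous fun ω : En n => c + t • ω)).norm.add
      (ph1_cont_ω Q η c t).norm).measurable.ennreal_ofReal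
  set Y : sphere (0 : En n) 1 → ℝ := fun ω =>
    (1 + 2 * β) * ‖ph0 f η (c + t • ω.1)‖ + ‖ph1 f η ω.1 (c + t • ω.1)‖ with hY
  have hYc : Continuous Y := by
    refine (continuous_const.mul ((ph0_cont f η).comp (by fun_prop)).norm).add
      ((ph1_cont_ω f η c t).comp continuous_subtype_val).norm
  have hstep1 : ∫⁻ ω in sphere (0 : En n) 1,
      ENNReal.ofReal (‖ph0 Q η (c + t • ω)‖ + ‖ph1 Q η ω (c + t • ω)‖) ∂(μH[(n : ℝ) - 1]) ≤
      C₂ * ∫⁻ ω : sphere (0 : En n) 1, ENNReal.ofReal (wt β η (c + t • ω.1) * Y ω) ∂σ := by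
    refine (lintegral_mono' h₂ le_rfl).trans ?_
    rw [lintegral_smul_measure, lintegral_map hmeas measurable_subtype_coe, smul_eq_mul]
    gcongr with ω
    exact ph_bound β hβ f Q hf η ω.1 _ (by simp)
  have hcs := cs_lintegral σ (fun ω => wt β η (c + t • ω.1)) Y
    ((wt_cont β η).comp (by fun_prop : Continuous fun ω : sphere (0 : En n) 1 => c + t • ω.1)).measurable
    hYc.measurable (fun ω => wt_nonneg _ _ _) (fun ω => by positivity)
  have hY2 : ∫⁻ ω, ENNReal.ofReal (Y ω ^ 2) ∂σ ≤ ENNReal.ofReal (2 * (1 + 2 * β) ^ 2) *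
      ∫⁻ ω : sphere (0 : En n) 1,
        ENNReal.ofReal (‖ph0 f η (c + t • ω.1)‖ ^ 2 + ‖ph1 f η ω.1 (c + t • ω.1)‖ ^ 2) ∂σ := by
    rw [← lintegral_const_mul' _ _ ENNReal.ofReal_ne_top]
    refine lintegral_mono fun ω => ?_
    rw [← ENNReal.ofReal_mul (by positivity)]
    apply ENNReal.ofReal_le_ofReal
    simp only [hY]
    refine add_sq_le.trans ?_
    have : 1 ≤ (1 + 2 * β) ^ 2 := by nlinarith
    nlinarith [sq_nonneg ‖ph1 f η ω.1 (c + t • ω.1)‖]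
  have htr := trace_Phi hn f η c t ht
  have hT : ∫⁻ ξ, ENNReal.ofReal (32 * (N2 f ξ * N2 f (η - ξ))) = ENNReal.ofReal 32 * TT f η := by
    unfold TT
    rw [← lintegral_const_mul' _ _ ENNReal.ofReal_ne_top]
    refine lintegral_congr fun ξ => ?_
    rw [ENNReal.ofReal_mul (by norm_num)]
  rw [hT] at htr
  have htr' : ∫⁻ ω : sphere (0 : En n) 1,
        ENNReal.ofReal (‖ph0 f η (c + t • ω.1)‖ ^ 2 + ‖ph1 f η ω.1 (c + t • ω.1)‖ ^ 2) ∂σ ≤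
      ENNReal.ofReal ((t ^ (n - 1))⁻¹) * (ENNReal.ofReal 32 * TT f η) := by
    have htp : 0 < t ^ (n - 1) := by positivity
    rw [ENNReal.ofReal_inv_of_pos htp]
    rw [mul_comm, ← div_eq_mul_inv, ENNReal.le_div_iff_mul_le (Or.inl (by simpa using htp))
      (Or.inl ENNReal.ofReal_ne_top), mul_comm]
    exact htr
  calc _ ≤ (C₂ * ∫⁻ ω : sphere (0 : En n) 1, ENNReal.ofReal (wt β η (c + t • ω.1) * Y ω) ∂σ) ^ 2 :=
        pow_le_pow_left₀ zero_le hstep1 2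
    _ ≤ C₂ ^ 2 * (ENNReal.ofReal (C₁ * jap η ^ (-(2 * β)) * t ^ (-(2 * s))) *
        (ENNReal.ofReal (2 * (1 + 2 * β) ^ 2) *
          (ENNReal.ofReal ((t ^ (n - 1))⁻¹) * (ENNReal.ofReal 32 * TT f η)))) := by
        rw [mul_pow]
        gcongr
        refine hcs.trans (mul_le_mul' (h₁ η c t ht) (hY2.trans ?_))
        gcongr
    _ = _ := by
        rw [← ENNReal.ofReal_toReal hC₂, ← ENNReal.ofReal_pow (by positivity)]
        simp only [← mul_assoc]
        rw [← ENNReal.ofReal_mul (by positivity), ← ENNReal.ofReal_mul (by positivity),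
          ← ENNReal.ofReal_mul (by positivity), ← ENNReal.ofReal_mul (by positivity)]
        congr 2
        simp only [ENNReal.toReal_ofReal ENNReal.toReal_nonneg]
        ring

lemma nu_finite {n : ℕ} (hn : 2 ≤ n) :
    IsFiniteMeasure ((μH[(n : ℝ) - 1] : Measure (En n)).restrict (sphere (0 : En n) 1)) := by
  obtain ⟨C, hC, h⟩ := hausdorff_dom hn
  refine ⟨(h univ).trans_lt ?_⟩
  rw [Measure.smul_apply, smul_eq_mul, Measure.map_apply measurable_subtype_coe MeasurableSet.univ]
  exact ENNReal.mul_lt_top hC.lt_top (measure_lt_top _ _)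

lemma schwartz_bdd {n : ℕ} {F : Type*} [NormedAddCommGroup F] [NormedSpace ℝ F] (g : 𝓢(En n, F)) :
    ∃ B : ℝ, 0 ≤ B ∧ ∀ x, ‖g x‖ ≤ B := by
  obtain ⟨B, hB⟩ := g.decay 0 0
  refine ⟨B, hB.1.le, fun x => ?_⟩
  simpa using hB.2 x

open LineDeriv in
lemma ph1_bdd {n : ℕ} (Q : 𝓢(En n, ℂ)) : ∃ B : ℝ, 0 ≤ B ∧ ∀ η ω ξ : En n, ‖ω‖ = 1 → ‖ph1 Q η ω ξ‖ ≤ B := by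
  obtain ⟨B0, h00, h0⟩ := schwartz_bdd Q
  obtain ⟨B1, h10, h1⟩ := schwartz_bdd (SchwartzMap.fderivCLM ℝ (En n) ℂ Q)
  refine ⟨B1 * B0 + B0 * B1, by positivity, fun η ω ξ hω => ?_⟩
  have h2 : ∀ x, ‖(∂_{ω} Q : 𝓢(En n, ℂ)) x‖ ≤ B1 := by
    intro x
    refine ((fderiv ℝ Q x).le_opNorm ω).trans ?_
    rw [hω, mul_one]
    exact h1 x
  unfold ph1
  refine (norm_sub_le _ _).trans ?_
  rw [norm_mul, norm_mul]
  gcongr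
  · exact h2 _
  · exact h0 _
  · exact h0 _
  · exact h2 _

lemma J_deriv {n : ℕ} (hn : 2 ≤ n) (Q : 𝓢(En n, ℂ)) (η c : En n) (k : ℝ) (r : ℝ) :
    HasDerivAt (fun r : ℝ => ∫ ω in sphere (0 : En n) 1, ph0 Q η (c + (r * k) • ω) ∂(μH[(n : ℝ) - 1]))
      (∫ ω in sphere (0 : En n) 1, k • ph1 Q η ω (c + (r * k) • ω) ∂(μH[(n : ℝ) - 1])) r := by
  have := nu_finite hn
  obtain ⟨B, hB0, hB⟩ := ph1_bdd Q
  obtain ⟨B0, h00, h0⟩ := schwartz_bdd Q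
  have hc : ∀ r : ℝ, Continuous fun ω : En n => ph0 Q η (c + (r * k) • ω) := fun r =>
    (ph0_cont Q η).comp (by fun_prop)
  refine (hasDerivAt_integral_of_dominated_loc_of_deriv_le (s := univ) (bound := fun _ => |k| * B)
    (F := fun (r : ℝ) (ω : En n) => ph0 Q η (c + (r * k) • ω))
    (F' := fun (r : ℝ) (ω : En n) => k • ph1 Q η ω (c + (r * k) • ω))
    univ_mem ?_ ?_ ?_ ?_ ?_ ?_).2
  · exact Eventually.of_forall fun r => (hc r).aestronglyMeasurable
  · refine Integrable.of_bound (hc r).aestronglyMeasurable (B0 * B0) (Eventually.of_forall fun ω => ?_)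
    unfold ph0
    rw [norm_mul]
    exact mul_le_mul (h0 _) (h0 _) (norm_nonneg _) h00
  · exact ((ph1_cont_ω Q η c (r * k)).const_smul k).aestronglyMeasurable
  · filter_upwards [ae_restrict_mem isClosed_sphere.measurableSet] with ω hω r _
    rw [norm_smul, Real.norm_eq_abs]
    gcongr
    exact hB _ _ _ (by simpa using hω)
  · exact integrable_const _
  · refine Eventually.of_forall fun ω r _ => ?_
    have h1 : HasDerivAt (fun r : ℝ => r * k) k r := by simpa using (hasDerivAt_id r).mul_const k
    exact (ph0_ray Q η c ω (r * k)).scomp r h1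

lemma m_deriv (N : ℕ) (r : ℝ) (hr : 0 < r) (hr2 : r < 2) :
    ∃ d : ℝ, HasDerivAt (fun r : ℝ => r ^ N * (r + 1)⁻¹) d r ∧ |d| ≤ (N + 1) * 2 ^ N ∧
      |r ^ N * (r + 1)⁻¹| ≤ (N + 1) * 2 ^ N := by
  have h1 : HasDerivAt (fun r : ℝ => (r + 1)⁻¹) (-1 / (r + 1) ^ 2) r :=
    ((hasDerivAt_id r).add_const 1).inv (by simp; linarith)
  refine ⟨_, (hasDerivAt_pow N r).mul h1, ?_, ?_⟩
  · have e1 : r ^ (N - 1) ≤ 2 ^ N := by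
      calc r ^ (N - 1) ≤ 2 ^ (N - 1) := pow_le_pow_left₀ hr.le hr2.le _
        _ ≤ 2 ^ N := pow_le_pow_right₀ (by norm_num) (by omega)
    have e2 : r ^ N ≤ 2 ^ N := pow_le_pow_left₀ hr.le hr2.le _
    have e3 : (r + 1)⁻¹ ≤ 1 := inv_le_one_of_one_le₀ (by linarith)
    have e4 : |(-1 / (r + 1) ^ 2)| ≤ 1 := by
      rw [abs_div, abs_neg, abs_one, abs_of_pos (by positivity), div_le_one (by positivity)]
      nlinarith
    refine (abs_add_le _ _).trans ?_
    rw [abs_mul, abs_mul (r ^ N), abs_of_pos (show 0 < r ^ N by positivity),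
      abs_of_nonneg (show 0 ≤ (N : ℝ) * r ^ (N - 1) by positivity),
      abs_of_pos (show 0 < (r + 1)⁻¹ by positivity)]
    calc _ ≤ (N : ℝ) * 2 ^ N * 1 + 2 ^ N * 1 := by gcongr
      _ = _ := by ring
  · have e2 : r ^ N ≤ 2 ^ N := pow_le_pow_left₀ hr.le hr2.le _
    have e3 : (r + 1)⁻¹ ≤ 1 := inv_le_one_of_one_le₀ (by linarith)
    rw [abs_of_pos (by positivity)]
    calc _ ≤ (2 : ℝ) ^ N * 1 := by gcongr
      _ ≤ _ := by
        have : (0 : ℝ) ≤ N * 2 ^ N := by positivity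
        linarith

lemma Psi_lip {n : ℕ} (hn : 2 ≤ n) (δ : ℝ) (hδ : δ < 1) (Q : 𝓢(En n, ℂ)) (η c : En n)
    (k B : ℝ) (hk : 1 ≤ k) (hB : 0 ≤ B)
    (hbd : ∀ r ∈ Ioo (1 - δ) (1 + δ), ∫⁻ ω in sphere (0 : En n) 1,
      ENNReal.ofReal (‖ph0 Q η (c + (r * k) • ω)‖ + ‖ph1 Q η ω (c + (r * k) • ω)‖)
        ∂(μH[(n : ℝ) - 1]) ≤ ENNReal.ofReal B)
    (r₁ r₂ : ℝ) (h₁ : r₁ ∈ Ioo (1 - δ) (1 + δ)) (h₂ : r₂ ∈ Ioo (1 - δ) (1 + δ)) :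
    ‖(r₁ ^ (n - 1) * (r₁ + 1)⁻¹) • (∫ ω in sphere (0 : En n) 1, ph0 Q η (c + (r₁ * k) • ω) ∂(μH[(n : ℝ) - 1]))
      - (r₂ ^ (n - 1) * (r₂ + 1)⁻¹) • (∫ ω in sphere (0 : En n) 1, ph0 Q η (c + (r₂ * k) • ω) ∂(μH[(n : ℝ) - 1]))‖
      ≤ (2 * (((n - 1 : ℕ) : ℝ) + 1) * 2 ^ (n - 1)) * (k * B) * |r₁ - r₂| := by
  set K : ℝ := (((n - 1 : ℕ) : ℝ) + 1) * 2 ^ (n - 1) with hK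
  have hK0 : 0 ≤ K := by positivity
  choose! d hd hd1 hd2 using m_deriv (n - 1)
  have key := Convex.norm_image_sub_le_of_norm_hasDerivWithin_le
    (f := fun r : ℝ => (r ^ (n - 1) * (r + 1)⁻¹) •
      (∫ ω in sphere (0 : En n) 1, ph0 Q η (c + (r * k) • ω) ∂(μH[(n : ℝ) - 1])))
    (f' := fun r : ℝ => (r ^ (n - 1) * (r + 1)⁻¹) •
      (∫ ω in sphere (0 : En n) 1, k • ph1 Q η ω (c + (r * k) • ω) ∂(μH[(n : ℝ) - 1])) +
      d r • (∫ ω in sphere (0 : En n) 1, ph0 Q η (c + (r * k) • ω) ∂(μH[(n : ℝ) - 1])))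
    (s := Ioo (1 - δ) (1 + δ)) (C := 2 * K * (k * B)) ?_ ?_ (convex_Ioo _ _) h₂ h₁
  · rw [Real.norm_eq_abs] at key
    calc _ ≤ _ := key
      _ = _ := by rw [hK]; ring
  · intro r hr
    exact ((hd r (by linarith [hr.1]) (by linarith [hr.2])).smul (J_deriv hn Q η c k r)).hasDerivWithinAt
  · intro r hr
    have b1 := hd1 r (by linarith [hr.1]) (by linarith [hr.2])
    have b2 := hd2 r (by linarith [hr.1]) (by linarith [hr.2])
    have hb := hbd r hr
    have n0 : ‖∫ ω in sphere (0 : En n) 1, ph0 Q η (c + (r * k) • ω) ∂(μH[(n : ℝ) - 1])‖ ≤ B := by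
      refine (norm_integral_le_lintegral_norm _).trans (ENNReal.toReal_le_of_le_ofReal hB (le_trans ?_ hb))
      refine lintegral_mono fun ω => ENNReal.ofReal_le_ofReal ?_
      linarith [norm_nonneg (ph1 Q η ω (c + (r * k) • ω))]
    have n1 : ‖∫ ω in sphere (0 : En n) 1, ph1 Q η ω (c + (r * k) • ω) ∂(μH[(n : ℝ) - 1])‖ ≤ B := by
      refine (norm_integral_le_lintegral_norm _).trans (ENNReal.toReal_le_of_le_ofReal hB (le_trans ?_ hb))
      refine lintegral_mono fun ω => ENNReal.ofReal_le_ofReal ?_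
      linarith [norm_nonneg (ph0 Q η (c + (r * k) • ω))]
    rw [integral_smul]
    refine (norm_add_le _ _).trans ?_
    rw [norm_smul, norm_smul, norm_smul, Real.norm_eq_abs, Real.norm_eq_abs, Real.norm_eq_abs,
      abs_of_pos (show 0 < k by linarith)]
    calc _ ≤ K * (k * B) + K * B := by gcongr
      _ ≤ K * (k * B) + K * (k * B) := by
        gcongr
        exact le_mul_of_one_le_left hB hk
      _ = _ := by ring

lemma kval_ge {n : ℕ} (θ η : En n) (hθ : ‖θ‖ = 1) (h : ⟪η, θ⟫ < 0) : ‖η‖ ≤ kval θ η := by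
  unfold kval
  rw [real_inner_comm, neg_div, ← div_neg]
  have h1 : -⟪η, θ⟫ ≤ ‖η‖ := by
    have := abs_real_inner_le_norm η θ
    rw [hθ, mul_one] at this
    linarith [neg_abs_le ⟪η, θ⟫]
  rw [le_div_iff₀ (by linarith)]
  nlinarith [norm_nonneg η]

lemma Sop_eq {n : ℕ} (hn : 2 ≤ n) (θ η : En n) (h : ⟪η, θ⟫ < 0) (hk : 0 < kval θ η) (r : ℝ)
    (hr : 0 < r) (q : 𝓢(En n, ℂ)) :
    Sop θ r ⇑q η = ((kval θ η)⁻¹ * kval θ η ^ (n - 1)) • ((r ^ (n - 1) * (r + 1)⁻¹) •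
      ∫ ω in sphere (0 : En n) 1, ph0 (𝓕 q) η (-(kval θ η • θ) + (r * kval θ η) • ω) ∂(μH[(n : ℝ) - 1])) := by
  unfold Sop ewald
  rw [if_pos h]
  have := sphere_scale hn (-(kval θ η • θ)) (r * kval θ η) (by positivity)
    (fun ξ => 𝓕 (⇑q) ξ * 𝓕 (⇑q) (η - ξ))
  rw [this, smul_smul, smul_smul]
  congr 1
  rw [mul_pow, mul_inv]; ring

lemma jap_le_two {n : ℕ} (η : En n) (k : ℝ) (h1 : 1 ≤ ‖η‖) (hk : ‖η‖ ≤ k) : jap η ≤ 2 * k := by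
  refine (pow_le_pow_iff_left₀ (jap_pos η).le (by linarith) two_ne_zero).1 ?_
  rw [jap_sq]
  nlinarith

lemma weight_le {n : ℕ} (hn : 2 ≤ n) (α β s : ℝ)
    (hs2 : 2 * max (α - β) 0 + (n : ℝ) - 3 - 2 * s ≤ 0) (η : En n) (k : ℝ) (h1 : 1 ≤ ‖η‖)
    (hk : ‖η‖ ≤ k) :
    jap η ^ (2 * α) * jap η ^ (-(2 * β)) * ((k⁻¹ * k ^ (n - 1)) ^ 2 * (k ^ (-(2 * s)) * (k ^ (n - 1))⁻¹))
      ≤ 2 ^ (2 * max (α - β) 0) := by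
  set γ := max (α - β) 0 with hγ
  have hγ0 : 0 ≤ γ := le_max_right _ _
  have hγ1 : α - β ≤ γ := le_max_left _ _
  have hk1 : 1 ≤ k := h1.trans hk
  have hk0 : 0 < k := by linarith
  have hj := jap_pos η
  have e1 : jap η ^ (2 * α) * jap η ^ (-(2 * β)) ≤ 2 ^ (2 * γ) * k ^ (2 * γ) := by
    rw [← Real.rpow_add hj, ← Real.mul_rpow (by norm_num) hk0.le]
    calc _ ≤ jap η ^ (2 * γ) := Real.rpow_le_rpow_of_exponent_le (one_le_jap η) (by linarith)
      _ ≤ _ := Real.rpow_le_rpow hj.le (jap_le_two η k h1 hk) (by linarith)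
  have hn1 : ((n - 1 : ℕ) : ℝ) = (n : ℝ) - 1 := by
    rw [Nat.cast_sub (by omega)]; simp
  have e2 : (k⁻¹ * k ^ (n - 1)) ^ 2 * (k ^ (-(2 * s)) * (k ^ (n - 1))⁻¹) = k ^ ((n : ℝ) - 3 - 2 * s) := by
    have e3 : (k⁻¹ * k ^ (n - 1)) ^ 2 * (k ^ (-(2 * s)) * (k ^ (n - 1))⁻¹) =
        k ^ (n - 1) * (k ^ (2 : ℕ))⁻¹ * k ^ (-(2 * s)) := by
      field_simp
    rw [e3, ← Real.rpow_natCast k (n - 1), ← Real.rpow_natCast k 2, ← Real.rpow_neg hk0.le,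
      ← Real.rpow_add hk0, ← Real.rpow_add hk0, hn1]
    congr 1; push_cast; ring
  rw [e2]
  calc _ ≤ (2 ^ (2 * γ) * k ^ (2 * γ)) * k ^ ((n : ℝ) - 3 - 2 * s) := by gcongr
    _ = 2 ^ (2 * γ) * k ^ (2 * γ + ((n : ℝ) - 3 - 2 * s)) := by
      rw [mul_assoc, ← Real.rpow_add hk0]
    _ ≤ 2 ^ (2 * γ) * 1 := by
      gcongr
      exact Real.rpow_le_one_of_one_le_of_nonpos hk1 (by linarith)
    _ = _ := mul_one _

lemma pointwise_est {n : ℕ} (hn : 2 ≤ n) (α β s δ : ℝ) (hβ : 0 ≤ β) (hs : 0 ≤ s) (hsβ : s ≤ β)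
    (hsn : 2 * s < (n : ℝ) - 1) (hs2 : 2 * max (α - β) 0 + (n : ℝ) - 3 - 2 * s ≤ 0)
    (hδ : δ < 1) :
    ∃ C : ℝ, 0 < C ∧ ∀ (θ : En n), ‖θ‖ = 1 → ∀ r₁ ∈ Ioo (1 - δ) (1 + δ), ∀ r₂ ∈ Ioo (1 - δ) (1 + δ),
      ∀ (q f : 𝓢(En n, ℂ)), (∀ ξ, f ξ = (jap ξ ^ β : ℝ) • (𝓕 q : 𝓢(En n, ℂ)) ξ) →
      ∀ (η : En n) (x : ℝ), ⟪η, θ⟫ < 0 → 1 ≤ ‖η‖ → x ∈ Icc (0 : ℝ) 1 →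
        ENNReal.ofReal (jap η ^ (2 * α) *
          ‖((kval θ η)⁻¹ * x) • (Sop θ r₁ ⇑q η - Sop θ r₂ ⇑q η)‖ ^ 2) ≤
          ENNReal.ofReal (C * |r₁ - r₂| ^ 2) * TT f η := by
  obtain ⟨C₁, hC₁, hA⟩ := sphere_A hn β s hβ hs hsβ hsn
  set a := 1 - δ with ha
  have ha0 : 0 < a := by linarith
  set K : ℝ := 2 * (((n - 1 : ℕ) : ℝ) + 1) * 2 ^ (n - 1) with hK
  have hK0 : 0 ≤ K := by positivity
  refine ⟨K ^ 2 * (C₁ * a ^ (-(2 * s)) * (a ^ (n - 1))⁻¹ * 2 ^ (2 * max (α - β) 0)) + 1, by positivity,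
    fun θ hθ r₁ h₁ r₂ h₂ q f hf η x hη hη1 hx => ?_⟩
  have hkη := kval_ge θ η hθ hη
  set k := kval θ η with hk
  have hk1 : 1 ≤ k := hη1.trans hkη
  have hk0 : 0 < k := by linarith
  have hj := jap_pos η
  by_cases hr : r₁ = r₂
  · subst hr; simp
  by_cases hT : TT f η = ⊤
  · rw [hT, ENNReal.mul_top]
    · exact le_top
    · have : 0 < |r₁ - r₂| := abs_pos.2 (sub_ne_zero.2 hr)
      rw [Ne, ENNReal.ofReal_eq_zero, not_le]
      positivity
  set T := (TT f η).toReal with hTT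
  have hT0 : 0 ≤ T := ENNReal.toReal_nonneg
  set B2 : ℝ := C₁ * jap η ^ (-(2 * β)) * ((a ^ (-(2 * s)) * k ^ (-(2 * s))) *
    ((a ^ (n - 1))⁻¹ * (k ^ (n - 1))⁻¹)) * T with hB2
  have hB20 : 0 ≤ B2 := by positivity
  have hbd : ∀ r ∈ Ioo (1 - δ) (1 + δ), ∫⁻ ω in sphere (0 : En n) 1,
      ENNReal.ofReal (‖ph0 (𝓕 q) η (-(k • θ) + (r * k) • ω)‖ + ‖ph1 (𝓕 q) η ω (-(k • θ) + (r * k) • ω)‖)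
        ∂(μH[(n : ℝ) - 1]) ≤ ENNReal.ofReal (√B2) := by
    intro r hr
    have hra : a < r := hr.1
    have hr0 : 0 < r := ha0.trans hra
    have h := hA f (𝓕 q) hf η (-(k • θ)) (r * k) (by positivity)
    rw [← ENNReal.ofReal_toReal hT, ← ENNReal.ofReal_mul (by positivity)] at h
    have h' : (∫⁻ ω in sphere (0 : En n) 1,
      ENNReal.ofReal (‖ph0 (𝓕 q) η (-(k • θ) + (r * k) • ω)‖ + ‖ph1 (𝓕 q) η ω (-(k • θ) + (r * k) • ω)‖)
        ∂(μH[(n : ℝ) - 1])) ^ 2 ≤ ENNReal.ofReal (√B2) ^ 2 := by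
      refine h.trans ?_
      rw [← ENNReal.ofReal_pow (Real.sqrt_nonneg _), Real.sq_sqrt hB20]
      apply ENNReal.ofReal_le_ofReal
      rw [hB2, ← Real.mul_rpow ha0.le hk0.le, ← mul_inv, ← mul_pow, mul_assoc (C₁ * _)]
      have e1 : (r * k) ^ (-(2 * s)) ≤ (a * k) ^ (-(2 * s)) :=
        Real.rpow_le_rpow_of_nonpos (by positivity) (by gcongr) (by linarith)
      have e2 : ((r * k) ^ (n - 1))⁻¹ ≤ ((a * k) ^ (n - 1))⁻¹ := by gcongr
      gcongr
    exact (ENNReal.pow_le_pow_left_iff two_ne_zero).1 h'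
  have hlip := Psi_lip hn δ hδ (𝓕 q) η (-(k • θ)) k (√B2) hk1 (Real.sqrt_nonneg _) hbd r₁ r₂ h₁ h₂
  rw [Sop_eq hn θ η hη hk0 r₁ (by linarith [h₁.1]) q, Sop_eq hn θ η hη hk0 r₂ (by linarith [h₂.1]) q,
    ← smul_sub, ← ENNReal.ofReal_toReal hT, ← ENNReal.ofReal_mul (by positivity)]
  apply ENNReal.ofReal_le_ofReal
  rw [norm_smul, norm_smul, Real.norm_of_nonneg (mul_nonneg (inv_nonneg.2 hk0.le) hx.1),
    Real.norm_of_nonneg (by positivity), ← hk]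
  rw [← hK] at hlip
  have hw := weight_le hn α β s hs2 η k hη1 hkη
  calc _ ≤ jap η ^ (2 * α) * (k⁻¹ * 1 * (k⁻¹ * k ^ (n - 1) * (K * (k * √B2) * |r₁ - r₂|))) ^ 2 := by
        have hx1 := hx.2
        have hx0 := hx.1
        gcongr
    _ = jap η ^ (2 * α) * (k⁻¹ * k ^ (n - 1)) ^ 2 * K ^ 2 * (√B2) ^ 2 * |r₁ - r₂| ^ 2 := by
        field_simp
    _ = (jap η ^ (2 * α) * jap η ^ (-(2 * β)) * ((k⁻¹ * k ^ (n - 1)) ^ 2 *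
          (k ^ (-(2 * s)) * (k ^ (n - 1))⁻¹))) * (K ^ 2 * (C₁ * a ^ (-(2 * s)) * (a ^ (n - 1))⁻¹))
          * |r₁ - r₂| ^ 2 * T := by
        rw [Real.sq_sqrt hB20, hB2]; ring
    _ ≤ 2 ^ (2 * max (α - β) 0) * (K ^ 2 * (C₁ * a ^ (-(2 * s)) * (a ^ (n - 1))⁻¹))
          * |r₁ - r₂| ^ 2 * T := by gcongr
    _ ≤ _ := by
        have : 0 ≤ |r₁ - r₂| ^ 2 * T := by positivity
        nlinarith

lemma exponent_choice {n : ℕ} (hn : 2 ≤ n) (α β : ℝ) (hβ : 0 ≤ β)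
    (hα : (((n : ℝ) - 3) / 2 < β ∧ β < ((n : ℝ) - 1) / 2 ∧
            α ≤ 2 * β - ((n : ℝ) - 3) / 2) ∨
          (((n : ℝ) - 1) / 2 ≤ β ∧ α < β + 1)) :
    ∃ s : ℝ, 0 ≤ s ∧ s ≤ β ∧ 2 * s < (n : ℝ) - 1 ∧
      2 * max (α - β) 0 + (n : ℝ) - 3 - 2 * s ≤ 0 := by
  have hn' : (2 : ℝ) ≤ n := by exact_mod_cast hn
  rcases hα with ⟨h1, h2, h3⟩ | ⟨h1, h2⟩
  · refine ⟨β, hβ, le_rfl, by linarith, ?_⟩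
    rcases max_cases (α - β) 0 with ⟨h, _⟩ | ⟨h, _⟩ <;> rw [h] <;> linarith
  · have hm : max (α - β) 0 < 1 := max_lt (by linarith) (by norm_num)
    refine ⟨max 0 (max (α - β) 0 + ((n : ℝ) - 3) / 2), le_max_left _ _, ?_, ?_, ?_⟩
    · exact max_le hβ (by linarith)
    · have : max 0 (max (α - β) 0 + ((n : ℝ) - 3) / 2) < ((n : ℝ) - 1) / 2 :=
        max_lt (by linarith) (by linarith)
      linarith
    · have := le_max_right 0 (max (α - β) 0 + ((n : ℝ) - 3) / 2)
      linarith

lemma lintegral_TT {n : ℕ} (f : 𝓢(En n, ℂ)) :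
    ∫⁻ η, TT f η = (∫⁻ ξ, ENNReal.ofReal (N2 f ξ)) ^ 2 := by
  have hm : Measurable (fun ξ : En n => ENNReal.ofReal (N2 f ξ)) :=
    (N2_cont f).measurable.ennreal_ofReal
  unfold TT
  simp_rw [ENNReal.ofReal_mul (N2_nonneg f _)]
  rw [lintegral_lintegral_swap]
  · have : ∀ ξ : En n, ∫⁻ η, ENNReal.ofReal (N2 f ξ) * ENNReal.ofReal (N2 f (η - ξ)) =
        ENNReal.ofReal (N2 f ξ) * ∫⁻ η, ENNReal.ofReal (N2 f η) := by
      intro ξ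
      rw [lintegral_const_mul' _ _ ENNReal.ofReal_ne_top,
        lintegral_sub_right_eq_self (fun η => ENNReal.ofReal (N2 f η)) ξ]
    simp_rw [this]
    rw [lintegral_mul_const _ hm, sq]
  · exact ((hm.comp measurable_snd).mul
      (hm.comp (measurable_fst.sub measurable_snd))).aemeasurable

lemma integral_le_of_lintegral_le {n : ℕ} (G : En n → ℝ) (hG : ∀ η, 0 ≤ G η) (B : ℝ) (hB : 0 ≤ B)
    (h : ∫⁻ η, ENNReal.ofReal (G η) ≤ ENNReal.ofReal B) : ∫ η, G η ≤ B := by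
  by_cases hi : Integrable G
  · rw [integral_eq_lintegral_of_nonneg_ae (Eventually.of_forall hG) hi.1]
    exact ENNReal.toReal_le_of_le_ofReal hB h
  · rw [integral_undef hi]; exact hB

/-- Lipschitz estimate in `r` for the (cut-off) spherical operator (Proposition 3.5):
`‖k⁻¹(S̃_{θ,r₁}(q) - S̃_{θ,r₂}(q))‖_{L²_α} ≤ C |r₁ - r₂| ‖q‖²_{W^{β,2}_2}`. -/
theorem spherical_operator_lipschitz_estimate (n : ℕ) (hn : 2 ≤ n) (β C₀ α : ℝ)
    (hβ : 0 ≤ β) (hC₀ : 1 < C₀) (χ : En n → ℝ) (hχ : IsCutoff C₀ χ)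
    (hα : (((n : ℝ) - 3) / 2 < β ∧ β < ((n : ℝ) - 1) / 2 ∧
            α ≤ 2 * β - ((n : ℝ) - 3) / 2) ∨
          (((n : ℝ) - 1) / 2 ≤ β ∧ α < β + 1)) :
    ∀ δ : ℝ, 0 < δ → δ < 1 →
      ∃ C : ℝ, 0 < C ∧ ∀ θ : En n, ‖θ‖ = 1 →
        ∀ r₁ ∈ Set.Ioo (1 - δ) (1 + δ), ∀ r₂ ∈ Set.Ioo (1 - δ) (1 + δ),
          ∀ q : 𝓢(En n, ℂ),
            L2w α (fun η => if ⟪η, θ⟫ < 0 then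
                ((kval θ η)⁻¹ * χ η) • (Sop θ r₁ ⇑q η - Sop θ r₂ ⇑q η) else 0)
              ≤ C * |r₁ - r₂| * sobNorm β 2 ⇑q ^ 2 := by
  intro δ hδ0 hδ
  obtain ⟨s, hs, hsβ, hsn, hs2⟩ := exponent_choice hn α β hβ hα
  obtain ⟨C, hC, hP⟩ := pointwise_est hn α β s δ hβ hs hsβ hsn hs2 hδ
  obtain ⟨D, hD, hS⟩ := sobolev_N2 n
  refine ⟨Real.sqrt C * D + 1, by positivity, fun θ hθ r₁ hr₁ r₂ hr₂ q => ?_⟩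
  set f : 𝓢(En n, ℂ) := SchwartzMap.smulLeftCLM ℂ (fun x : En n => jap x ^ β) (𝓕 q) with hf
  have hf' : ∀ ξ, f ξ = (jap ξ ^ β : ℝ) • (𝓕 q : 𝓢(En n, ℂ)) ξ := fun ξ => by
    rw [hf, SchwartzMap.smulLeftCLM_apply_apply (jap_rpow_temperate β)]
  set I : ℝ := ∫ x, jap x ^ (2 * (2 : ℝ)) * ‖(𝓕⁻ f : 𝓢(En n, ℂ)) x‖ ^ 2 with hI
  have hjn : ∀ x : En n, 0 ≤ jap x := fun x => Real.sqrt_nonneg _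
  have hI0 : 0 ≤ I := integral_nonneg fun x =>
    mul_nonneg (Real.rpow_nonneg (hjn x) _) (sq_nonneg _)
  have hfun : (fun ξ => (jap ξ ^ β : ℝ) • 𝓕 (⇑q) ξ) = ⇑f := by
    funext ξ
    rw [hf', SchwartzMap.fourier_coe]
  have hsob : sobNorm β 2 ⇑q ^ 2 = I := by
    unfold sobNorm
    rw [hfun, ← SchwartzMap.fourierInv_coe, ← hI, ← Real.sqrt_eq_rpow, Real.sq_sqrt hI0]
  rw [hsob]
  unfold L2w
  rw [← Real.sqrt_eq_rpow]
  have hpt : ∀ η : En n, ENNReal.ofReal (jap η ^ (2 * α) * ‖(if ⟪η, θ⟫ < 0 then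
      ((kval θ η)⁻¹ * χ η) • (Sop θ r₁ ⇑q η - Sop θ r₂ ⇑q η) else 0 : ℂ)‖ ^ 2) ≤
      ENNReal.ofReal (C * |r₁ - r₂| ^ 2) * TT f η := by
    intro η
    by_cases h : ⟪η, θ⟫ < 0
    · rw [if_pos h]
      by_cases h1 : 1 ≤ ‖η‖
      · exact hP θ hθ r₁ hr₁ r₂ hr₂ q f hf' η (χ η) h h1 (hχ.mem_Icc η)
      · rw [hχ.eq_zero η (by linarith [not_le.mp h1])]
        simp
    · rw [if_neg h]; simp
  have hbd : ∫ η, jap η ^ (2 * α) * ‖(if ⟪η, θ⟫ < 0 then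
      ((kval θ η)⁻¹ * χ η) • (Sop θ r₁ ⇑q η - Sop θ r₂ ⇑q η) else 0 : ℂ)‖ ^ 2 ≤
      C * |r₁ - r₂| ^ 2 * (D * I) ^ 2 := by
    refine integral_le_of_lintegral_le _
      (fun η => mul_nonneg (Real.rpow_nonneg (hjn η) _) (sq_nonneg _)) _ (by positivity) ?_
    refine (lintegral_mono hpt).trans ?_
    rw [lintegral_const_mul' _ _ ENNReal.ofReal_ne_top, lintegral_TT,
      ENNReal.ofReal_mul (p := C * |r₁ - r₂| ^ 2) (by positivity),
      ENNReal.ofReal_pow (p := D * I) (by positivity)]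
    exact mul_le_mul_right (pow_le_pow_left' (hS f) 2) _
  refine (Real.sqrt_le_sqrt hbd).trans ?_
  have he : C * |r₁ - r₂| ^ 2 * (D * I) ^ 2 = C * (|r₁ - r₂| * (D * I)) ^ 2 := by ring
  rw [he, Real.sqrt_mul hC.le, Real.sqrt_sq (by positivity)]
  have : 0 ≤ |r₁ - r₂| * I := by positivity
  nlinarith

end
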